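/- arXiv:2408.04101 — 5 statements merged into one kernel-verified Lean document; each statement's English description precedes it below -/
import Mathlib

section
/- Let μ_X, μ_Y ∈ ℝ, σ_X, σ_Y > 0, ρ ∈ (−1,1) and n ≥ 1 an integer. Then S_n has the same distribution as (s/2)(1+ρ)V₁ − (s/2)(1−ρ)V₂, where V₁ ~ χ'²_n(λ₊) and V₂ ~ χ'²_n(λ₋) are independent, with λ₊ = (n/(2(1+ρ)))(μ_X/σ_X + μ_Y/σ_Y)² and λ₋ = (n/(2(1−ρ)))(μ_X/σ_X − μ_Y/σ_Y)². -/
open MeasureTheory ProbabilityTheory Real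

noncomputable section

/-- Modified Bessel function of the first kind,
`I ν y = ∑_{k=0}^∞ (y/2)^{2k+ν} / (k! Γ(k+ν+1))`. -/
def besselI (ν y : ℝ) : ℝ :=
  ∑' k : ℕ, (y / 2) ^ (2 * (k : ℝ) + ν) / ((k.factorial : ℝ) * Real.Gamma ((k : ℝ) + ν + 1))

/-- The density of the noncentral chi-square distribution with `r` degrees of freedom and
noncentrality parameter `lam` (for `lam = 0`, the chi-square density). -/
def ncChiSqPdf (r lam x : ℝ) : ℝ :=
  if x ≤ 0 then 0
  else if lam = 0 then x ^ (r / 2 - 1) * Real.exp (-x / 2) / (2 ^ (r / 2) * Real.Gamma (r / 2))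
  else (1 / 2) * Real.exp (-(x + lam) / 2) * (x / lam) ^ (r / 4 - 1 / 2) *
    besselI (r / 2 - 1) (Real.sqrt (lam * x))

/-- The noncentral chi-square distribution `χ'²_r(lam)` as a measure on `ℝ`. -/
def ncChiSq (r lam : ℝ) : Measure ℝ :=
  volume.withDensity fun x => ENNReal.ofReal (ncChiSqPdf r lam x)

/-- The law of the difference `T = V₁ - V₂` of independent noncentral chi-square random
variables `V₁ ~ χ'²_r(λ₁)` and `V₂ ~ χ'²_r(λ₂)`. -/
def ncChiSqDiff (r lam1 lam2 : ℝ) : Measure ℝ :=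
  Measure.map (fun p : ℝ × ℝ => p.1 - p.2) ((ncChiSq r lam1).prod (ncChiSq r lam2))

/-- The bivariate normal distribution with mean vector `(μX, μY)`, variances `(σX², σY²)` and
correlation coefficient `ρ`, realised as the law of
`(μX + σX N₁, μY + σY (ρ N₁ + √(1-ρ²) N₂))` for independent standard normals `N₁, N₂`. -/
def binormal (μX μY σX σY ρ : ℝ) : Measure (ℝ × ℝ) :=
  Measure.map (fun p : ℝ × ℝ =>
      (μX + σX * p.1, μY + σY * (ρ * p.1 + Real.sqrt (1 - ρ ^ 2) * p.2)))
    ((gaussianReal 0 1).prod (gaussianReal 0 1))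

/-- The law of the product `Z = XY` of bivariate normal random variables. -/
def prodNormal (μX μY σX σY ρ : ℝ) : Measure ℝ :=
  Measure.map (fun p : ℝ × ℝ => p.1 * p.2) (binormal μX μY σX σY ρ)

/-- The law of the sum `Sₙ = Z₁ + ⋯ + Zₙ` of `n` independent copies of `Z = XY`. -/
def sumProdNormal (n : ℕ) (μX μY σX σY ρ : ℝ) : Measure ℝ :=
  Measure.map (fun x : Fin n → ℝ => ∑ i, x i)
    (Measure.pi fun _ : Fin n => prodNormal μX μY σX σY ρ)

lemma Gamma_mul_pow_le_Gamma_natCast_add {b : ℝ} (hb : 0 < b) (k : ℕ) :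
    Real.Gamma b * b ^ k ≤ Real.Gamma (k + b) := by
  induction k with
  | zero => simp
  | succ k ih =>
    have hkb : 0 < (k : ℝ) + b := by positivity
    rw [show ((k + 1 : ℕ) : ℝ) + b = (k + b) + 1 by push_cast; ring, Real.Gamma_add_one hkb.ne',
      pow_succ, ← mul_assoc, mul_comm]
    have := (Real.Gamma_pos_of_pos hkb).le
    gcongr
    linarith [(Nat.cast_nonneg k : (0 : ℝ) ≤ k)]

lemma summable_besselI {ν y : ℝ} (hν : -1 < ν) (hy : 0 < y) :
    Summable fun k : ℕ =>
      (y / 2) ^ (2 * (k : ℝ) + ν) / ((k.factorial : ℝ) * Real.Gamma ((k : ℝ) + ν + 1)) := by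
  have hb : 0 < ν + 1 := by linarith
  have hy2 : 0 < y / 2 := by positivity
  have hΓ : 0 < Real.Gamma (ν + 1) := Real.Gamma_pos_of_pos hb
  refine Summable.of_nonneg_of_le (fun k => ?_) (fun k => ?_)
    ((Real.summable_pow_div_factorial ((y / 2) ^ 2 / (ν + 1))).mul_left
      ((y / 2) ^ ν / Real.Gamma (ν + 1)))
  · have : 0 < Real.Gamma ((k : ℝ) + ν + 1) := Real.Gamma_pos_of_pos (by linarith [(Nat.cast_nonneg k : (0 : ℝ) ≤ k)])
    positivity
  · have h := Gamma_mul_pow_le_Gamma_natCast_add hb k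
    rw [← add_assoc] at h
    rw [Real.rpow_add hy2, show (2 * (k : ℝ)) = ((2 * k : ℕ) : ℝ) by push_cast; ring,
      Real.rpow_natCast, pow_mul, div_pow _ (ν + 1), div_div, div_mul_div_comm]
    rw [mul_comm ((y / 2) ^ ν), ← mul_assoc (Real.Gamma _), mul_comm (k.factorial : ℝ)]
    gcongr

/-- The noncentral chi-square density is a Poisson mixture of gamma densities. -/
lemma hasSum_ncChiSqPdf {r lam x : ℝ} (hr : 0 < r) (hlam : 0 ≤ lam) (hx : 0 < x) :
    HasSum (fun k : ℕ => Real.exp (-lam / 2) * ((lam / 2) ^ k / k.factorial) *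
      gammaPDFReal (r / 2 + k) (1 / 2) x) (ncChiSqPdf r lam x) := by
  rw [ncChiSqPdf, if_neg hx.not_ge]
  split_ifs with h0
  · subst h0
    convert hasSum_single (0 : ℕ) (fun k hk => ?_) using 1
    · have h2 : (2 : ℝ) ^ (r / 2) ≠ 0 := by positivity
      simp only [gammaPDFReal, hx.le, if_true]
      rw [one_div, Real.inv_rpow two_pos.le]
      have : -(2⁻¹ * x) = - x / 2 := by ring
      simp [this]
      field_simp
    · simp [hk]
  · have hl : 0 < lam := lt_of_le_of_ne hlam (Ne.symm h0)
    have hs := (summable_besselI (ν := r / 2 - 1) (by linarith)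
      (Real.sqrt_pos.2 (mul_pos hl hx))).hasSum.mul_left
      ((1 / 2) * Real.exp (-(x + lam) / 2) * (x / lam) ^ (r / 4 - 1 / 2))
    refine (congrArg (HasSum · _) (funext fun k => ?_)).mpr hs
    simp only [gammaPDFReal, hx.le, if_true]
    have hexp : Real.exp (-(x + lam) / 2) = Real.exp (-lam / 2) * Real.exp (-(1 / 2 * x)) := by
      rw [← Real.exp_add]; congr 1; ring
    have hpow : (√(lam * x) / 2) ^ (2 * (k : ℝ) + (r / 2 - 1)) * (x / lam) ^ (r / 4 - 1 / 2) =
        (lam / 2) ^ k * (Real.exp (Real.log 2) * (1 / 2) ^ (r / 2 + k) * x ^ (r / 2 + k - 1)) := by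
      have hsqrt : √(lam * x) / 2 = Real.exp ((Real.log lam + Real.log x) / 2 - Real.log 2) := by
        rw [Real.exp_sub, Real.exp_log two_pos, ← Real.log_mul hl.ne' hx.ne', ← Real.log_sqrt
          (by positivity), Real.exp_log (by positivity)]
      rw [← Real.rpow_natCast (lam / 2) k, hsqrt, ← Real.exp_mul,
        Real.rpow_def_of_pos (by positivity), Real.rpow_def_of_pos (by positivity),
        Real.rpow_def_of_pos (by positivity), Real.rpow_def_of_pos hx,
        Real.log_div hx.ne' hl.ne', Real.log_div hl.ne' two_ne_zero, one_div, Real.log_inv]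
      simp only [← Real.exp_add]
      congr 1
      ring
    rw [show (k : ℝ) + (r / 2 - 1) + 1 = r / 2 + k by ring, hexp, mul_assoc _ ((x / lam) ^ _),
      ← mul_div_assoc ((x / lam) ^ _), mul_comm ((x / lam) ^ _), hpow, Real.exp_log two_pos]
    field_simp

lemma measurable_ncChiSqPdf (r lam : ℝ) : Measurable (ncChiSqPdf r lam) := by
  have hb : Measurable (besselI (r / 2 - 1)) := by
    unfold besselI
    fun_prop
  unfold ncChiSqPdf
  refine Measurable.ite measurableSet_Iic measurable_const ?_
  by_cases h : lam = 0 <;> simp only [h, if_true, if_false] <;> fun_prop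

lemma gammaPDF_mul_ofReal_exp {a b t : ℝ} (ha : 0 < a) (hb : 0 < b) (htb : t < b) (x : ℝ) :
    gammaPDF a b x * ENNReal.ofReal (Real.exp (t * x)) =
      ENNReal.ofReal ((b / (b - t)) ^ a) * gammaPDF a (b - t) x := by
  have hbt : 0 < b - t := sub_pos.2 htb
  rw [gammaPDF, gammaPDF, ← ENNReal.ofReal_mul (gammaPDFReal_nonneg ha hb x),
    ← ENNReal.ofReal_mul (by positivity)]
  congr 1
  unfold gammaPDFReal
  split_ifs
  · rw [Real.div_rpow hb.le hbt.le, show -((b - t) * x) = -(b * x) + t * x by ring, Real.exp_add]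
    have : (b - t) ^ a ≠ 0 := by positivity
    field_simp
  · simp

lemma lintegral_exp_ncChiSq {r lam t : ℝ} (hr : 0 < r) (hlam : 0 ≤ lam) (ht : t < 1 / 2) :
    ∫⁻ x, ENNReal.ofReal (Real.exp (t * x)) ∂(ncChiSq r lam) =
      ENNReal.ofReal ((1 - 2 * t) ^ (-(r / 2)) * Real.exp (lam * t / (1 - 2 * t))) := by
  have hc : 0 < 1 - 2 * t := by linarith
  rw [ncChiSq, lintegral_withDensity_eq_lintegral_mul _
    (measurable_ncChiSqPdf r lam).ennreal_ofReal (by fun_prop)]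
  have key : (fun x => ENNReal.ofReal (ncChiSqPdf r lam x) * ENNReal.ofReal (Real.exp (t * x)))
      =ᵐ[volume] fun x => ∑' k : ℕ, ENNReal.ofReal (Real.exp (-lam / 2) *
        ((lam / 2) ^ k / k.factorial) * (1 / 2 / (1 / 2 - t)) ^ (r / 2 + k)) *
          gammaPDF (r / 2 + k) (1 / 2 - t) x := by
    filter_upwards [Measure.ae_ne volume (0 : ℝ)] with x hx0
    rcases lt_or_gt_of_ne hx0 with hx | hx
    · simp [ncChiSqPdf, hx.le, gammaPDF_of_neg hx]
    · have hs := hasSum_ncChiSqPdf hr hlam hx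
      have hn : ∀ k : ℕ, 0 ≤ gammaPDFReal (r / 2 + k) (1 / 2) x := fun k =>
        gammaPDFReal_nonneg (by positivity) (by norm_num) x
      rw [← hs.tsum_eq, ENNReal.ofReal_tsum_of_nonneg
        (fun k => mul_nonneg (by positivity) (hn k)) hs.summable, ← ENNReal.tsum_mul_right]
      refine tsum_congr fun k => ?_
      rw [ENNReal.ofReal_mul (by positivity), mul_assoc, ← gammaPDF,
        gammaPDF_mul_ofReal_exp (by positivity) (by norm_num) ht, ← mul_assoc,
        ← ENNReal.ofReal_mul (by positivity)]
  have hd : 0 < 1 / 2 / (1 / 2 - t) := div_pos (by norm_num) (by linarith)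
  simp only [Pi.mul_apply]
  rw [lintegral_congr_ae key, lintegral_tsum (fun k => by unfold gammaPDF; fun_prop)]
  have hk : ∀ k : ℕ, ∫⁻ x, ENNReal.ofReal (Real.exp (-lam / 2) *
        ((lam / 2) ^ k / k.factorial) * (1 / 2 / (1 / 2 - t)) ^ (r / 2 + k)) *
          gammaPDF (r / 2 + k) (1 / 2 - t) x = ENNReal.ofReal (Real.exp (-lam / 2) *
        (1 / 2 / (1 / 2 - t)) ^ (r / 2) * ((lam / 2 * (1 / 2 / (1 / 2 - t))) ^ k / k.factorial)) := by
    intro k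
    rw [lintegral_const_mul' _ _ ENNReal.ofReal_ne_top,
      lintegral_gammaPDF_eq_one (by positivity) (by linarith), mul_one, Real.rpow_add hd,
      Real.rpow_natCast, mul_pow]
    congr 1
    ring
  simp_rw [hk]
  have hsum := (NormedSpace.expSeries_div_hasSum_exp (lam / 2 * (1 / 2 / (1 / 2 - t)))).mul_left
    (Real.exp (-lam / 2) * (1 / 2 / (1 / 2 - t)) ^ (r / 2))
  rw [← ENNReal.ofReal_tsum_of_nonneg (fun k => by positivity) hsum.summable, hsum.tsum_eq,
    ← Real.exp_eq_exp_ℝ]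
  congr 1
  have e : 1 / 2 / (1 / 2 - t) = (1 - 2 * t)⁻¹ := by
    have : 1 / 2 - t ≠ 0 := by linarith
    field_simp
  rw [e, Real.inv_rpow hc.le, ← Real.rpow_neg hc.le, mul_right_comm, ← Real.exp_add, mul_comm]
  congr 2
  field_simp
  ring

lemma isProbabilityMeasure_ncChiSq {r lam : ℝ} (hr : 0 < r) (hlam : 0 ≤ lam) :
    IsProbabilityMeasure (ncChiSq r lam) := by
  have := lintegral_exp_ncChiSq (t := 0) hr hlam (by norm_num)
  exact ⟨by simpa using this⟩

lemma mgf_id_ncChiSq {r lam t : ℝ} (hr : 0 < r) (hlam : 0 ≤ lam) (ht : t < 1 / 2) :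
    mgf id (ncChiSq r lam) t =
      (1 - 2 * t) ^ (-(r / 2)) * Real.exp (lam * t / (1 - 2 * t)) := by
  have hc : 0 < 1 - 2 * t := by linarith
  simp only [mgf, id]
  rw [integral_eq_lintegral_of_nonneg_ae (ae_of_all _ fun x => (Real.exp_pos _).le)
    (by fun_prop), lintegral_exp_ncChiSq hr hlam ht, ENNReal.toReal_ofReal (by positivity)]

lemma integral_exp_mul_sq_gaussianReal (m : ℝ) {t : ℝ} (ht : t < 1 / 2) :
    ∫ x, Real.exp (t * (m + x) ^ 2) ∂(gaussianReal 0 1) =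
      (1 - 2 * t) ^ (-(1 / 2) : ℝ) * Real.exp (m ^ 2 * t / (1 - 2 * t)) := by
  have hc : 0 < 1 - 2 * t := by linarith
  rw [integral_gaussianReal_eq_integral_smul one_ne_zero]
  have key : ∀ x, gaussianPDFReal 0 1 x • Real.exp (t * (m + x) ^ 2) =
      (1 - 2 * t) ^ (-(1 / 2) : ℝ) * Real.exp (m ^ 2 * t / (1 - 2 * t)) *
        gaussianPDFReal (2 * t * m / (1 - 2 * t)) (Real.toNNReal (1 - 2 * t)⁻¹) x := by
    intro x
    simp only [gaussianPDFReal, smul_eq_mul, NNReal.coe_one, Real.coe_toNNReal _ (inv_pos.2 hc).le, mul_one,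
      sub_zero]
    rw [Real.rpow_neg hc.le, ← Real.sqrt_eq_rpow, Real.sqrt_mul' _ (inv_pos.2 hc).le,
      Real.sqrt_inv]
    have hs : √(1 - 2 * t) ≠ 0 := by positivity
    rw [mul_assoc, ← Real.exp_add]
    have : -x ^ 2 / 2 + t * (m + x) ^ 2 = m ^ 2 * t / (1 - 2 * t) +
        -(x - 2 * t * m / (1 - 2 * t)) ^ 2 / (2 * (1 - 2 * t)⁻¹) := by
      field_simp
      ring
    rw [this, Real.exp_add]
    field_simp
  simp_rw [key]
  rw [integral_const_mul, integral_gaussianPDFReal_eq_one, mul_one]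
  simpa using hc

/-- A probability measure on `ℝ` is determined by its moment-generating function on `(-∞, a)`,
`a > 0`, when the latter is finite there. -/
lemma ext_of_mgf_eqOn_Iio {μ ν : Measure ℝ} [IsProbabilityMeasure μ] [IsProbabilityMeasure ν]
    {a : ℝ} (ha : 0 < a) (h : ∀ t < a, mgf id μ t = mgf id ν t) (h0 : ∀ t < a, 0 < mgf id μ t) :
    μ = ν := by
  have hμ : Set.Iio a ⊆ interior (integrableExpSet id μ) :=
    interior_maximal (fun t ht => mgf_pos_iff.1 (h0 t ht)) isOpen_Iio
  have hν : Set.Iio a ⊆ interior (integrableExpSet id ν) :=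
    interior_maximal (fun t ht => mgf_pos_iff.1 (h t ht ▸ h0 t ht)) isOpen_Iio
  have heq : Set.EqOn (complexMGF id μ) (complexMGF id ν) {z | z.re ∈ Set.Iio a} := by
    refine AnalyticOnNhd.eqOn_of_preconnected_of_frequently_eq (z₀ := ((0 : ℝ) : ℂ))
      (fun z hz => analyticOnNhd_complexMGF z (hμ hz))
      (fun z hz => analyticOnNhd_complexMGF z (hν hz))
      ((convex_Iio a).linear_preimage Complex.reLm).isPreconnected (by simpa using ha) ?_
    have hmap : Filter.Tendsto ((↑) : ℝ → ℂ) (nhdsWithin 0 {0}ᶜ)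
        (nhdsWithin ((0 : ℝ) : ℂ) {((0 : ℝ) : ℂ)}ᶜ) :=
      Complex.continuous_ofReal.continuousWithinAt.tendsto_nhdsWithin fun x hx => by simpa using hx
    refine hmap.frequently (Filter.Eventually.frequently ?_)
    filter_upwards [nhdsWithin_le_nhds (Iio_mem_nhds ha)] with t ht
    rw [complexMGF_ofReal, complexMGF_ofReal, h t ht]
  refine Measure.ext_of_charFun (funext fun t => ?_)
  rw [← complexMGF_id_mul_I, ← complexMGF_id_mul_I]
  exact heq (by simpa using ha)

/-- The sum of the squares of `n` independent `N(m, 1)` variables is noncentral chi-square. -/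
lemma map_sum_sq_pi_gaussianReal {n : ℕ} (hn : 1 ≤ n) (m : ℝ) :
    (Measure.pi fun _ : Fin n => gaussianReal 0 1).map (fun x => ∑ i, (m + x i) ^ 2) =
      ncChiSq n (n * m ^ 2) := by
  have hr : (0 : ℝ) < n := by exact_mod_cast hn
  have hlam : 0 ≤ n * m ^ 2 := by positivity
  have hX : Measurable fun x : Fin n → ℝ => ∑ i, (m + x i) ^ 2 := by fun_prop
  have := isProbabilityMeasure_ncChiSq hr hlam
  have := Measure.isProbabilityMeasure_map (μ := Measure.pi fun _ : Fin n => gaussianReal 0 1)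
    hX.aemeasurable
  have hmgf : ∀ t < (1 / 2 : ℝ), mgf id ((Measure.pi fun _ : Fin n => gaussianReal 0 1).map
      (fun x => ∑ i, (m + x i) ^ 2)) t =
        (1 - 2 * t) ^ (-((n : ℝ) / 2)) * Real.exp (n * m ^ 2 * t / (1 - 2 * t)) := by
    intro t ht
    have hc : 0 < 1 - 2 * t := by linarith
    rw [mgf_id_map hX.aemeasurable, mgf]
    simp_rw [Finset.mul_sum, Real.exp_sum]
    rw [integral_fintype_prod_eq_prod (fun _ y => Real.exp (t * (m + y) ^ 2)),
      integral_exp_mul_sq_gaussianReal m ht, Finset.prod_const, Finset.card_univ, Fintype.card_fin,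
      mul_pow, ← Real.rpow_mul_natCast hc.le, ← Real.exp_nat_mul]
    congr 2 <;> ring
  refine ext_of_mgf_eqOn_Iio (a := 1 / 2) (by norm_num) (fun t ht => ?_) (fun t ht => ?_)
  · rw [hmgf t ht, mgf_id_ncChiSq hr hlam ht]
  · have hc : 0 < 1 - 2 * t := by linarith
    rw [hmgf t ht]
    positivity

/-- The product of two correlated normal variables is a difference of scaled squares of
independent normal variables. -/
lemma prodNormal_eq_map_sq_sub_sq {μX μY σX σY ρ : ℝ} (hσX : 0 < σX) (hσY : 0 < σY)
    (hρ : ρ ∈ Set.Ioo (-1 : ℝ) 1) :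
    prodNormal μX μY σX σY ρ = ((gaussianReal 0 1).prod (gaussianReal 0 1)).map (fun p : ℝ × ℝ =>
      σX * σY / 2 * (1 + ρ) * ((μX / σX + μY / σY) / √(2 * (1 + ρ)) + p.1) ^ 2 -
        σX * σY / 2 * (1 - ρ) * (-((μX / σX - μY / σY) / √(2 * (1 - ρ))) + p.2) ^ 2) := by
  obtain ⟨h1, h2⟩ := hρ
  have hp : 0 < 1 + ρ := by linarith
  have hm : 0 < 1 - ρ := by linarith
  have hsin : Real.sin (Real.arcsin √((1 - ρ) / 2)) = √((1 - ρ) / 2) :=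
    Real.sin_arcsin (by linarith [Real.sqrt_nonneg ((1 - ρ) / 2)])
      (Real.sqrt_le_one.2 (by linarith))
  have hcos : Real.cos (Real.arcsin √((1 - ρ) / 2)) = √((1 + ρ) / 2) := by
    rw [Real.cos_arcsin, Real.sq_sqrt (by linarith)]
    congr 1
    ring
  have hrot := IsGaussian.map_rotation_eq_self (μ := gaussianReal 0 1) (by simp)
    (Real.arcsin √((1 - ρ) / 2))
  rw [prodNormal, binormal, Measure.map_map (by fun_prop) (by fun_prop)]
  conv_rhs => rw [← hrot, Measure.map_map (by fun_prop) (by fun_prop)]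
  congr 1
  ext ⟨x, y⟩
  simp only [Function.comp_apply, ContinuousLinearMap.rotation_apply, hsin, hcos, smul_eq_mul]
  rw [show 1 - ρ ^ 2 = (1 + ρ) * (1 - ρ) by ring, Real.sqrt_mul hp.le, Real.sqrt_mul two_pos.le,
    Real.sqrt_mul two_pos.le, Real.sqrt_div hp.le, Real.sqrt_div hm.le]
  have e2 : √(2 : ℝ) ^ 2 = 2 := Real.sq_sqrt two_pos.le
  have ep : √(1 + ρ) ^ 2 = 1 + ρ := Real.sq_sqrt hp.le
  have em : √(1 - ρ) ^ 2 = 1 - ρ := Real.sq_sqrt hm.le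
  have n2 : √(2 : ℝ) ≠ 0 := by positivity
  have np : √(1 + ρ) ≠ 0 := by positivity
  have nm : √(1 - ρ) ≠ 0 := by positivity
  clear hrot hsin hcos
  generalize √(2 : ℝ) = w at *
  generalize √(1 + ρ) = u at *
  generalize √(1 - ρ) = v at *
  have hU : (1 + ρ) * ((μX / σX + μY / σY) / (w * u) +
      (u / w * x + v / w * y)) ^ 2 =
      (μX / σX + μY / σY + (1 + ρ) * x + u * v * y) ^ 2 / 2 := by
    rw [← e2, ← ep]
    field_simp
    ring
  have hW : (1 - ρ) * (-((μX / σX - μY / σY) / (w * v)) +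
      (-(v / w) * x + u / w * y)) ^ 2 =
      (μX / σX - μY / σY + (1 - ρ) * x - u * v * y) ^ 2 / 2 := by
    rw [← e2, ← em]
    field_simp
    ring
  rw [mul_assoc _ (1 + ρ), mul_assoc _ (1 - ρ), hU, hW]
  field_simp
  ring

/-- For `μX, μY ∈ ℝ`, `σX, σY > 0`, `ρ ∈ (-1,1)` and `n ≥ 1`, the sum `Sₙ`
has the same distribution as `(s/2)(1+ρ)V₁ - (s/2)(1-ρ)V₂`, where `s = σX σY` and
`V₁ ~ χ'²_n(λ₊)`, `V₂ ~ χ'²_n(λ₋)` are independent, with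
`λ₊ = (n/(2(1+ρ)))(μX/σX + μY/σY)²` and `λ₋ = (n/(2(1-ρ)))(μX/σX - μY/σY)²`. -/
theorem sumProdNormal_eq_ncChiSqDiff (μX μY σX σY ρ : ℝ) (hσX : 0 < σX) (hσY : 0 < σY)
    (hρ : ρ ∈ Set.Ioo (-1 : ℝ) 1) (n : ℕ) (hn : 1 ≤ n) :
    sumProdNormal n μX μY σX σY ρ =
      Measure.map
        (fun p : ℝ × ℝ =>
          σX * σY / 2 * (1 + ρ) * p.1 - σX * σY / 2 * (1 - ρ) * p.2)
        ((ncChiSq n ((n : ℝ) / (2 * (1 + ρ)) * (μX / σX + μY / σY) ^ 2)).prod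
          (ncChiSq n ((n : ℝ) / (2 * (1 - ρ)) * (μX / σX - μY / σY) ^ 2))) := by
  have hp : 0 < 1 + ρ := by linarith [hρ.1]
  have hm : 0 < 1 - ρ := by linarith [hρ.2]
  have hlp : (n : ℝ) / (2 * (1 + ρ)) * (μX / σX + μY / σY) ^ 2 =
      n * ((μX / σX + μY / σY) / √(2 * (1 + ρ))) ^ 2 := by
    rw [div_pow, Real.sq_sqrt (by positivity)]
    ring
  have hlm : (n : ℝ) / (2 * (1 - ρ)) * (μX / σX - μY / σY) ^ 2 =
      n * (-((μX / σX - μY / σY) / √(2 * (1 - ρ)))) ^ 2 := by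
    rw [neg_sq, div_pow, Real.sq_sqrt (by positivity)]
    ring
  rw [hlp, hlm, ← map_sum_sq_pi_gaussianReal hn, ← map_sum_sq_pi_gaussianReal hn,
    Measure.map_prod_map _ _ (by fun_prop) (by fun_prop), Measure.map_map (by fun_prop)
      (by fun_prop), sumProdNormal, prodNormal_eq_map_sq_sub_sq hσX hσY hρ,
    ← (measurePreserving_arrowProdEquivProdArrow ℝ ℝ (Fin n) (fun _ => gaussianReal 0 1)
      (fun _ => gaussianReal 0 1)).map_eq, Measure.map_map (by fun_prop) (by fun_prop)]
  have (i : Fin n) := Measure.isProbabilityMeasure_map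
    (μ := (gaussianReal 0 1).prod (gaussianReal 0 1)) (f := fun p : ℝ × ℝ =>
      σX * σY / 2 * (1 + ρ) * ((μX / σX + μY / σY) / √(2 * (1 + ρ)) + p.1) ^ 2 -
        σX * σY / 2 * (1 - ρ) * (-((μX / σX - μY / σY) / √(2 * (1 - ρ))) + p.2) ^ 2) (by fun_prop)
  rw [← Measure.pi_map_pi (fun _ => by fun_prop), Measure.map_map (by fun_prop) (by fun_prop)]
  congr 1
  ext x
  simp [MeasurableEquiv.arrowProdEquivProdArrow, Equiv.arrowProdEquivProdArrow,
    Finset.sum_sub_distrib, Finset.mul_sum]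

end
end

section
/- Let μ_X, μ_Y ∈ ℝ, σ_X, σ_Y > 0, n ≥ 1 an integer, and consider the degenerate case ρ = 1, i.e. X = σ_X N + μ_X and Y = σ_Y N + μ_Y for N ~ N(0,1). Then S_n has the same distribution as s V₁ − (n s/4)(μ_X/σ_X − μ_Y/σ_Y)², where V₁ ~ χ'²_n(λ₊) with λ₊ = n(μ_X/σ_X + μ_Y/σ_Y)²/4. -/
open MeasureTheory ProbabilityTheory Real

noncomputable section

/-- The law of `Z = XY` where `X = σX N + μX`, `Y = σY N + μY` for a single standard normal
`N` (the degenerate bivariate normal case `ρ = 1`). -/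
def prodNormalDegPos (μX μY σX σY : ℝ) : Measure ℝ :=
  Measure.map (fun x : ℝ => (σX * x + μX) * (σY * x + μY)) (gaussianReal 0 1)

/-- The law of the sum `Sₙ = Z₁ + ⋯ + Zₙ` of `n` independent copies of `Z` (case `ρ = 1`). -/
def sumProdNormalDegPos (n : ℕ) (μX μY σX σY : ℝ) : Measure ℝ :=
  Measure.map (fun x : Fin n → ℝ => ∑ i, x i)
    (Measure.pi fun _ : Fin n => prodNormalDegPos μX μY σX σY)

/-- The moment-generating function of the gamma distribution below its rate. -/
lemma mgf_id_gammaMeasure {a r t : ℝ} (ha : 0 < a) (hr : 0 < r) (ht : t < r) :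
    mgf id (gammaMeasure a r) t = (1 - t / r) ^ (-a) := by
  have h_toReal (x : ℝ) : (gammaPDF a r x).toReal = gammaPDFReal a r x :=
    ENNReal.toReal_ofReal (gammaPDFReal_nonneg ha hr x)
  have h_restrict : ∫ x, gammaPDFReal a r x * exp (t * x) =
      ∫ x in Set.Ici 0, gammaPDFReal a r x * exp (t * x) := by
    refine (setIntegral_eq_integral_of_forall_compl_eq_zero fun x hx => ?_).symm
    simp [gammaPDFReal, show ¬ 0 ≤ x from hx]
  have h_integrand : ∀ x ∈ Set.Ioi (0 : ℝ), gammaPDFReal a r x * exp (t * x) =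
      r ^ a / Gamma a * (x ^ (a - 1) * exp (-((r - t) * x))) := by
    intro x hx
    rw [gammaPDFReal, if_pos (le_of_lt hx), mul_assoc, mul_assoc, ← exp_add]
    ring_nf
  have hrt : 0 < r - t := sub_pos.2 ht
  have hΓ := (Gamma_pos_of_pos ha).ne'
  have h_div : 1 - t / r = (r - t) / r := by field_simp
  rw [mgf, gammaMeasure, integral_withDensity_eq_integral_toReal_smul
    (by unfold gammaPDF; fun_prop) (Filter.Eventually.of_forall fun x => by simp [gammaPDF])]
  simp only [h_toReal, smul_eq_mul, id]
  rw [h_restrict, integral_Ici_eq_integral_Ioi, setIntegral_congr_fun measurableSet_Ioi h_integrand,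
    integral_const_mul, integral_rpow_mul_exp_neg_mul_Ioi ha hrt, h_div,
    rpow_neg (div_pos hrt hr).le, div_rpow hrt.le hr.le, one_div, inv_rpow hrt.le]
  field_simp

lemma mem_integrableExpSet_gammaMeasure {a r t : ℝ} (ha : 0 < a) (hr : 0 < r) (ht : t < r) :
    t ∈ integrableExpSet id (gammaMeasure a r) := by
  have := isProbabilityMeasure_gammaMeasure ha hr
  have h_pos : 0 < 1 - t / r := sub_pos.2 ((div_lt_one hr).2 ht)
  refine mgf_pos_iff.1 ?_
  rw [mgf_id_gammaMeasure ha hr ht]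
  positivity

lemma complexMGF_id_gammaMeasure {a r : ℝ} (ha : 0 < a) (hr : 0 < r) {z : ℂ} (hz : z.re < r) :
    complexMGF id (gammaMeasure a r) z = (1 - z / r) ^ (-a : ℂ) := by
  have h_interior : Set.Iio r ⊆ interior (integrableExpSet id (gammaMeasure a r)) :=
    isOpen_Iio.subset_interior_iff.2 fun t ht => mem_integrableExpSet_gammaMeasure ha hr ht
  have h_left : AnalyticOnNhd ℂ (complexMGF id (gammaMeasure a r)) {z | z.re < r} :=
    analyticOnNhd_complexMGF.mono fun z hz => h_interior hz
  have h_right : AnalyticOnNhd ℂ (fun z : ℂ => (1 - z / r) ^ (-a : ℂ)) {z | z.re < r} := by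
    intro z hz
    refine AnalyticAt.cpow (by fun_prop) (by fun_prop) (Or.inl ?_)
    have : z.re / r < 1 := (div_lt_one hr).2 hz
    simpa [Complex.div_ofReal_re] using this
  refine h_left.eqOn_of_preconnected_of_frequently_eq h_right
    (convex_halfSpace_re_lt r).isPreconnected (z₀ := 0) (by simpa using hr) ?_ hz
  have h_real : ∀ᶠ x : ℝ in nhdsWithin 0 {0}ᶜ,
      complexMGF id (gammaMeasure a r) x = (1 - (x : ℂ) / r) ^ (-a : ℂ) := by
    filter_upwards [nhdsWithin_le_nhds (Iio_mem_nhds hr)] with x hx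
    rw [complexMGF_ofReal, mgf_id_gammaMeasure ha hr hx,
      Complex.ofReal_cpow (sub_pos.2 ((div_lt_one hr).2 hx)).le]
    push_cast
    rfl
  have h_tendsto : Filter.Tendsto ((↑) : ℝ → ℂ) (nhdsWithin 0 {0}ᶜ) (nhdsWithin 0 {0}ᶜ) := by
    refine tendsto_nhdsWithin_iff.2 ⟨?_, ?_⟩
    · exact (Complex.continuous_ofReal.tendsto' 0 0 rfl).mono_left nhdsWithin_le_nhds
    · filter_upwards [self_mem_nhdsWithin] with x hx
      simpa using hx
  exact h_tendsto.frequently h_real.frequently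

lemma charFun_gammaMeasure {a r : ℝ} (ha : 0 < a) (hr : 0 < r) (t : ℝ) :
    charFun (gammaMeasure a r) t = (1 - t * Complex.I / r) ^ (-a : ℂ) := by
  rw [← complexMGF_id_mul_I, complexMGF_id_gammaMeasure ha hr (by simpa using hr)]

/-- The characteristic function of the square of a unit-variance Gaussian variable. -/
lemma charFun_map_sq_gaussianReal (m t : ℝ) :
    charFun ((gaussianReal 0 1).map fun x => (x + m) ^ 2) t =
      (1 - 2 * t * Complex.I) ^ (-(1 / 2) : ℂ) *
        Complex.exp (m ^ 2 * t * Complex.I / (1 - 2 * t * Complex.I)) := by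
  have hv : (1 - 2 * t * Complex.I : ℂ) ≠ 0 := fun h => by simpa using congrArg Complex.re h
  have hv_arg : (1 - 2 * t * Complex.I : ℂ).arg ≠ π := fun h => by
    have := (Complex.arg_eq_pi_iff.1 h).1
    norm_num at this
  have h_integrand (x : ℝ) :
      gaussianPDFReal 0 1 x • Complex.exp (t * ((x + m) ^ 2 : ℝ) * Complex.I) =
        ((√(2 * π))⁻¹ : ℝ) * Complex.exp ((-(1 - 2 * t * Complex.I) / 2) * x ^ 2 +
          (2 * m * t * Complex.I) * x + m ^ 2 * t * Complex.I) := by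
    simp only [gaussianPDFReal, Complex.real_smul]
    push_cast
    rw [mul_one, mul_assoc, ← Complex.exp_add]
    congr 2
    ring
  have h_const : (((√(2 * π))⁻¹ : ℝ) : ℂ) * (2 * π : ℝ) ^ (1 / 2 : ℂ) = 1 := by
    have h : ((2 * π : ℝ) : ℂ) ^ (1 / 2 : ℂ) = (√(2 * π) : ℝ) := by
      rw [sqrt_eq_rpow, Complex.ofReal_cpow (by positivity)]
      push_cast
      rfl
    rw [h, ← Complex.ofReal_mul, inv_mul_cancel₀ (by positivity), Complex.ofReal_one]
  have h_pi : (π : ℂ) / -(-(1 - 2 * t * Complex.I) / 2) =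
      ((2 * π : ℝ) : ℂ) * (1 - 2 * t * Complex.I)⁻¹ := by
    push_cast
    field_simp
  have h_cpow : (((2 * π : ℝ) : ℂ) * (1 - 2 * t * Complex.I)⁻¹) ^ (1 / 2 : ℂ) =
      ((2 * π : ℝ) : ℂ) ^ (1 / 2 : ℂ) * (1 - 2 * t * Complex.I) ^ (-(1 / 2) : ℂ) := by
    have h2π : ((2 * π : ℝ) : ℂ) ≠ 0 := Complex.ofReal_ne_zero.2 (by positivity)
    rw [Complex.cpow_neg, ← Complex.inv_cpow _ _ hv_arg,
      Complex.cpow_def_of_ne_zero (mul_ne_zero h2π (inv_ne_zero hv)),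
      Complex.cpow_def_of_ne_zero h2π, Complex.cpow_def_of_ne_zero (inv_ne_zero hv),
      Complex.log_ofReal_mul (by positivity) (inv_ne_zero hv), Complex.ofReal_log (by positivity),
      add_mul, Complex.exp_add]
  rw [charFun_apply_real, integral_map (by fun_prop) (by fun_prop),
    integral_gaussianReal_eq_integral_smul one_ne_zero]
  simp_rw [h_integrand]
  rw [integral_const_mul, integral_cexp_quadratic (by norm_num), h_pi, h_cpow, ← mul_assoc,
    ← mul_assoc, h_const, one_mul]
  have h_complete_square (u v : ℂ) (hv : v ≠ 0) (hu : u = (1 - v) / 2) :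
      m ^ 2 * u - (2 * m * u) ^ 2 / (4 * (-v / 2)) = m ^ 2 * u / v := by
    subst hu
    field_simp
    ring
  have h_exponent := h_complete_square (t * Complex.I) _ hv (by ring)
  simp only [← mul_assoc] at h_exponent
  rw [h_exponent]

/-- The Poisson weights of mean `lam / 2`. -/
def ncChiSqWeight (lam : ℝ) (k : ℕ) : ℝ :=
  exp (-(lam / 2)) * (lam / 2) ^ k / k.factorial

lemma ncChiSqWeight_nonneg {lam : ℝ} (hlam : 0 ≤ lam) (k : ℕ) : 0 ≤ ncChiSqWeight lam k := by
  unfold ncChiSqWeight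
  positivity

lemma hasSum_ncChiSqWeight (lam : ℝ) : HasSum (ncChiSqWeight lam) 1 := by
  convert! (NormedSpace.expSeries_div_hasSum_exp (lam / 2)).mul_left (exp (-(lam / 2))) using 1
  · funext k
    rw [ncChiSqWeight, mul_div_assoc]
  · rw [← exp_eq_exp_ℝ, ← exp_add]
    simp

lemma summable_pow_div_factorial_mul_Gamma {a : ℝ} (ha : 0 < a) (y : ℝ) :
    Summable fun k : ℕ => y ^ k / (k.factorial * Gamma (a + k)) := by
  refine summable_of_ratio_norm_eventually_le (r := 1 / 2) (by norm_num) ?_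
  obtain ⟨N, hN⟩ := exists_nat_ge (2 * |y| / a)
  filter_upwards [Filter.eventually_ge_atTop N] with k hk
  have hk' : 2 * |y| ≤ a * k := by
    have : (N : ℝ) ≤ k := by exact_mod_cast hk
    rw [div_le_iff₀ ha] at hN
    nlinarith
  have hak : 0 < a + k := by positivity
  have hΓ := Gamma_pos_of_pos hak
  have h_step : y ^ (k + 1) / ((k + 1).factorial * Gamma (a + (k + 1 : ℕ))) =
      y / ((k + 1) * (a + k)) * (y ^ k / (k.factorial * Gamma (a + k))) := by
    rw [Nat.cast_add, Nat.cast_one, ← add_assoc, Gamma_add_one hak.ne', Nat.factorial_succ]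
    push_cast
    field_simp
    ring
  rw [h_step, norm_mul]
  refine mul_le_mul_of_nonneg_right ?_ (norm_nonneg _)
  rw [norm_div, norm_eq_abs, norm_eq_abs, abs_of_pos (by positivity : 0 < (k + 1) * (a + k)),
    div_le_iff₀ (by positivity)]
  nlinarith [sq_nonneg (k : ℝ)]

lemma weight_mul_gammaPDFReal {r lam x : ℝ} (hx : 0 < x) (k : ℕ) :
    ncChiSqWeight lam k * gammaPDFReal (r / 2 + k) (1 / 2) x =
      1 / 2 * exp (-(x + lam) / 2) * (x / 2) ^ (r / 2 - 1) *
        ((lam * x / 4) ^ k / (k.factorial * Gamma (r / 2 + k))) := by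
  have h_exp : exp (-(x + lam) / 2) = exp (-(lam / 2)) * exp (-(1 / 2 * x)) := by
    rw [← exp_add]
    ring_nf
  have h_half : (1 / 2 : ℝ) ^ (r / 2 + k) = (1 / 2) ^ (r / 2 - 1) * (1 / 2) * (1 / 2) ^ k := by
    rw [rpow_add_natCast (by norm_num), ← rpow_add_one (by norm_num)]
    ring_nf
  have h_pow : x ^ (r / 2 + k - 1) = x ^ (r / 2 - 1) * x ^ k := by
    rw [← rpow_add_natCast hx.ne']
    ring_nf
  have h_div : (x / 2) ^ (r / 2 - 1) = (1 / 2) ^ (r / 2 - 1) * x ^ (r / 2 - 1) := by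
    rw [← mul_rpow (by norm_num) hx.le]
    ring_nf
  have h_pow' : (lam * x / 4) ^ k = (lam / 2) ^ k * (1 / 2) ^ k * x ^ k := by
    rw [← mul_pow, ← mul_pow]
    ring_nf
  rw [ncChiSqWeight, gammaPDFReal, if_pos hx.le, h_exp, h_half, h_pow, h_div, h_pow']
  ring

lemma ncChiSqPdf_eq_tsum {r lam x : ℝ} (hlam : 0 ≤ lam) (hx : 0 < x) :
    ncChiSqPdf r lam x =
      ∑' k, ncChiSqWeight lam k * gammaPDFReal (r / 2 + k) (1 / 2) x := by
  rw [ncChiSqPdf, if_neg hx.not_ge]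
  split_ifs with h
  · subst h
    rw [tsum_eq_single 0 fun k hk => by simp [ncChiSqWeight, hk]]
    simp only [ncChiSqWeight, gammaPDFReal, if_pos hx.le, one_div, inv_rpow zero_le_two]
    have : -x / 2 = -(2⁻¹ * x) := by ring
    simp [this]
    field_simp
  · have hlam' : 0 < lam := lt_of_le_of_ne hlam (Ne.symm h)
    rw [besselI, ← tsum_mul_left]
    refine tsum_congr fun k => ?_
    have h_sq : √(lam * x) ^ 2 = lam * x := sq_sqrt (by positivity)
    have h_term : (√(lam * x) / 2) ^ (2 * (k : ℝ) + (r / 2 - 1)) =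
        (√(lam * x) / 2) ^ (r / 2 - 1) * (lam * x / 4) ^ k := by
      rw [add_comm, show 2 * (k : ℝ) = ((2 * k : ℕ) : ℝ) by push_cast; ring,
        rpow_add_natCast (by positivity), pow_mul, div_pow, h_sq]
      norm_num
    have h_base : (x / lam) ^ (r / 4 - 1 / 2) = √(x / lam) ^ (r / 2 - 1) := by
      rw [sqrt_eq_rpow, ← rpow_mul (by positivity)]
      ring_nf
    have h_mul : √(x / lam) * (√(lam * x) / 2) = x / 2 := by
      rw [← mul_div_assoc, ← sqrt_mul (by positivity),
        show x / lam * (lam * x) = x ^ 2 by field_simp, sqrt_sq hx.le]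
    rw [weight_mul_gammaPDFReal hx, h_term, h_base, ← h_mul,
      mul_rpow (by positivity) (by positivity),
      show (k : ℝ) + (r / 2 - 1) + 1 = r / 2 + k by ring]
    ring

/-- The noncentral chi-square distribution is a Poisson mixture of gamma distributions. -/
lemma ncChiSq_eq_sum {r lam : ℝ} (hr : 0 < r) (hlam : 0 ≤ lam) :
    ncChiSq r lam = Measure.sum fun k : ℕ =>
      ENNReal.ofReal (ncChiSqWeight lam k) • gammaMeasure (r / 2 + k) (1 / 2) := by
  have h_meas (k : ℕ) : Measurable (gammaPDF (r / 2 + k) (1 / 2)) := by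
    unfold gammaPDF
    fun_prop
  simp_rw [gammaMeasure, ← withDensity_smul _ (h_meas _)]
  rw [ncChiSq, ← withDensity_tsum fun k => (h_meas k).const_smul _]
  refine withDensity_congr_ae ?_
  filter_upwards [Measure.ae_ne volume (0 : ℝ)] with x hx
  rw [tsum_apply (Pi.summable.2 fun _ => ENNReal.summable)]
  rcases lt_or_gt_of_ne hx with hx | hx
  · simp [ncChiSqPdf, hx.le, gammaPDF_of_neg hx]
  · rw [ncChiSqPdf_eq_tsum hlam hx, ENNReal.ofReal_tsum_of_nonneg]
    · simp [gammaPDF, ENNReal.ofReal_mul (ncChiSqWeight_nonneg hlam _)]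
    · exact fun k => mul_nonneg (ncChiSqWeight_nonneg hlam k)
        (gammaPDFReal_nonneg (by positivity) (by norm_num) x)
    · simp_rw [weight_mul_gammaPDFReal hx]
      exact (summable_pow_div_factorial_mul_Gamma (half_pos hr) _).mul_left _

lemma charFun_ncChiSq {r lam : ℝ} (hr : 0 < r) (hlam : 0 ≤ lam) (t : ℝ) :
    charFun (ncChiSq r lam) t =
      (1 - 2 * t * Complex.I) ^ (-(r / 2) : ℂ) *
        Complex.exp (lam * t * Complex.I / (1 - 2 * t * Complex.I)) := by
  have := isProbabilityMeasure_ncChiSq hr hlam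
  have hv : (1 - 2 * t * Complex.I : ℂ) ≠ 0 := fun h => by simpa using congrArg Complex.re h
  have h_int : Integrable (fun x : ℝ => Complex.exp (t * x * Complex.I)) (ncChiSq r lam) := by
    refine Integrable.of_bound (by fun_prop) 1 (Filter.Eventually.of_forall fun x => ?_)
    rw [← Complex.ofReal_mul, Complex.norm_exp_ofReal_mul_I]
  have h_term (k : ℕ) : ∫ x, Complex.exp (t * x * Complex.I)
      ∂(ENNReal.ofReal (ncChiSqWeight lam k) • gammaMeasure (r / 2 + k) (1 / 2)) =
      Complex.exp (-(lam / 2)) * (1 - 2 * t * Complex.I) ^ (-(r / 2) : ℂ) *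
        ((lam / 2 / (1 - 2 * t * Complex.I)) ^ k / k.factorial) := by
    rw [integral_smul_measure, ← charFun_apply_real, charFun_gammaMeasure (by positivity)
      (by norm_num), ENNReal.toReal_ofReal (ncChiSqWeight_nonneg hlam k), ncChiSqWeight]
    have h_base : (1 - t * Complex.I / ((1 / 2 : ℝ) : ℂ)) = 1 - 2 * t * Complex.I := by
      push_cast
      ring
    have h_cpow : (1 - 2 * t * Complex.I) ^ (-((r / 2 + k : ℝ) : ℂ)) =
        (1 - 2 * t * Complex.I) ^ (-(r / 2) : ℂ) * ((1 - 2 * t * Complex.I) ^ k)⁻¹ := by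
      push_cast
      rw [neg_add, Complex.cpow_add _ _ hv, Complex.cpow_neg _ (k : ℂ), Complex.cpow_natCast]
    rw [h_base, h_cpow, Complex.real_smul, div_pow _ (1 - 2 * t * Complex.I)]
    push_cast
    ring
  rw [charFun_apply_real]
  rw [ncChiSq_eq_sum hr hlam] at h_int ⊢
  rw [integral_sum_measure h_int]
  simp_rw [h_term]
  rw [tsum_mul_left, (NormedSpace.expSeries_div_hasSum_exp
    ((lam : ℂ) / 2 / (1 - 2 * t * Complex.I))).tsum_eq, ← Complex.exp_eq_exp_ℂ, mul_right_comm,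
    ← Complex.exp_add, mul_comm]
  congr 2
  field_simp
  ring

/-- The sum of the squares of `n` independent normal variables of mean `m` and variance `1` is
noncentral chi-square with noncentrality parameter `n * m ^ 2`. -/
lemma map_sum_pi_map_sq_gaussianReal (m : ℝ) {n : ℕ} (hn : 1 ≤ n) :
    (Measure.pi fun _ : Fin n => (gaussianReal 0 1).map fun x => (x + m) ^ 2).map
      (fun x => ∑ i, x i) = ncChiSq n (n * m ^ 2) := by
  have hn' : (0 : ℝ) < n := by exact_mod_cast hn
  have := isProbabilityMeasure_ncChiSq hn' (by positivity : 0 ≤ n * m ^ 2)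
  have : IsProbabilityMeasure ((gaussianReal 0 1).map fun x : ℝ => (x + m) ^ 2) :=
    Measure.isProbabilityMeasure_map (by fun_prop)
  have : IsProbabilityMeasure ((Measure.pi fun _ : Fin n =>
      (gaussianReal 0 1).map fun x => (x + m) ^ 2).map (fun x => ∑ i, x i)) :=
    Measure.isProbabilityMeasure_map (by fun_prop)
  refine Measure.ext_of_charFun (funext fun t => ?_)
  rw [charFun_map_sum_pi_eq_prod, charFun_ncChiSq hn' (by positivity), Finset.prod_apply,
    Finset.prod_const, Finset.card_univ, Fintype.card_fin, charFun_map_sq_gaussianReal, mul_pow,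
    ← Complex.cpow_nat_mul, ← Complex.exp_nat_mul]
  congr 2
  · push_cast
    ring
  · push_cast
    ring

/-- In the degenerate case `ρ = 1`, the sum `Sₙ` has the same distribution as
`s V₁ - (n s/4)(μX/σX - μY/σY)²`, where `s = σX σY` and `V₁ ~ χ'²_n(λ₊)` with
`λ₊ = n (μX/σX + μY/σY)² / 4`. -/
theorem sumProdNormalDegPos_eq (μX μY σX σY : ℝ) (hσX : 0 < σX) (hσY : 0 < σY)
    (n : ℕ) (hn : 1 ≤ n) :
    sumProdNormalDegPos n μX μY σX σY =
      Measure.map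
        (fun v : ℝ =>
          σX * σY * v - (n : ℝ) * (σX * σY) / 4 * (μX / σX - μY / σY) ^ 2)
        (ncChiSq n ((n : ℝ) * (μX / σX + μY / σY) ^ 2 / 4)) := by
  have hν : IsProbabilityMeasure ((gaussianReal 0 1).map fun x : ℝ =>
      (x + (μX / σX + μY / σY) / 2) ^ 2) := Measure.isProbabilityMeasure_map (by fun_prop)
  have h_prod : prodNormalDegPos μX μY σX σY =
      ((gaussianReal 0 1).map fun x => (x + (μX / σX + μY / σY) / 2) ^ 2).map
        fun v => σX * σY * v - σX * σY / 4 * (μX / σX - μY / σY) ^ 2 := by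
    rw [prodNormalDegPos, Measure.map_map (by fun_prop) (by fun_prop)]
    congr 1
    ext x
    simp only [Function.comp_apply]
    field_simp
    ring
  have : IsProbabilityMeasure (((gaussianReal 0 1).map fun x : ℝ =>
      (x + (μX / σX + μY / σY) / 2) ^ 2).map
        fun v => σX * σY * v - σX * σY / 4 * (μX / σX - μY / σY) ^ 2) :=
    Measure.isProbabilityMeasure_map (by fun_prop)
  rw [sumProdNormalDegPos, h_prod, ← Measure.pi_map_pi fun _ => by fun_prop,
    Measure.map_map (by fun_prop) (by fun_prop),
    show (n : ℝ) * (μX / σX + μY / σY) ^ 2 / 4 = n * ((μX / σX + μY / σY) / 2) ^ 2 by ring,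
    ← map_sum_pi_map_sq_gaussianReal _ hn, Measure.map_map (by fun_prop) (by fun_prop)]
  congr 1
  ext x
  simp only [Function.comp_apply, Finset.sum_sub_distrib, ← Finset.mul_sum, Finset.sum_const,
    Finset.card_univ, Fintype.card_fin, nsmul_eq_mul]
  ring

end
end

section
/- Let T = V₁ − V₂, where V₁ ~ χ'²_r(λ) and V₂ ~ χ'²_r(λ) are independent, with r > 0 and λ ≥ 0 (equal noncentrality parameters λ₁ = λ₂ = λ). Then T has a probability density function given, for x ≠ 0, by p_T(x) = (1/(2^r √π)) e^{−λ} Σ_{k=0}^∞ ((λ/4)^k/(k! Γ(r/2+k))) |x|^{(r−1)/2 + k} K_{(r−1)/2 + k}(|x|/2). -/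
open MeasureTheory ProbabilityTheory Real

noncomputable section

/-- The modified Bessel function of the second kind,
`K ν x = ∫₀^∞ e^{-x cosh t} cosh (ν t) dt`. -/
def besselK (ν x : ℝ) : ℝ :=
  ∫ t in Set.Ioi (0 : ℝ), Real.exp (-x * Real.cosh t) * Real.cosh (ν * t)

namespace NcChiSq

open scoped ENNReal

/-- The term of index `k` of the Poisson distribution with mean `m`. -/
def poissonWeight (m : ℝ) (k : ℕ) : ℝ := Real.exp (-m) * m ^ k / (k.factorial : ℝ)

lemma poissonWeight_nonneg {m : ℝ} (hm : 0 ≤ m) (k : ℕ) : 0 ≤ poissonWeight m k := by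
  unfold poissonWeight; positivity

lemma hasSum_poissonWeight (m : ℝ) : HasSum (poissonWeight m) 1 := by
  have h := (NormedSpace.expSeries_div_hasSum_exp m).mul_left (Real.exp (-m))
  rw [← Real.exp_eq_exp_ℝ, ← Real.exp_add, neg_add_cancel, Real.exp_zero] at h
  simp only [← mul_div_assoc] at h
  exact h

lemma tsum_ofReal_poissonWeight {m : ℝ} (hm : 0 ≤ m) :
    ∑' k, ENNReal.ofReal (poissonWeight m k) = 1 := by
  rw [← ENNReal.ofReal_tsum_of_nonneg (poissonWeight_nonneg hm) (hasSum_poissonWeight m).summable,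
    (hasSum_poissonWeight m).tsum_eq, ENNReal.ofReal_one]

/-- The mixture of the measures `μ k` with Poisson weights of mean `m`. -/
def poissonMixture (m : ℝ) (μ : ℕ → Measure ℝ) : Measure ℝ :=
  Measure.sum fun k => ENNReal.ofReal (poissonWeight m k) • μ k

lemma isProbabilityMeasure_poissonMixture {m : ℝ} (hm : 0 ≤ m) {μ : ℕ → Measure ℝ}
    (hμ : ∀ k, IsProbabilityMeasure (μ k)) : IsProbabilityMeasure (poissonMixture m μ) where
  measure_univ := by
    simp [poissonMixture, Measure.sum_apply _ MeasurableSet.univ, tsum_ofReal_poissonWeight hm]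

lemma charFun_poissonMixture {m : ℝ} (hm : 0 ≤ m) {μ : ℕ → Measure ℝ}
    (hμ : ∀ k, IsProbabilityMeasure (μ k)) {t : ℝ} {A z : ℂ}
    (h : ∀ k, charFun (μ k) t = A * z ^ k) :
    charFun (poissonMixture m μ) t = A * Complex.exp (m * (z - 1)) := by
  have := isProbabilityMeasure_poissonMixture hm hμ
  have hint : Integrable (fun x : ℝ => Complex.exp (t * x * Complex.I)) (poissonMixture m μ) := by
    refine Integrable.of_bound (C := 1) (by fun_prop) (ae_of_all _ fun x => ?_)
    rw [← Complex.ofReal_mul, Complex.norm_exp_ofReal_mul_I]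
  have h1 := hasSum_integral_measure hint
  have h2 := (NormedSpace.expSeries_div_hasSum_exp (m * z : ℂ)).mul_left (A * Complex.exp (-m))
  rw [← Complex.exp_eq_exp_ℂ] at h2
  have hk : ∀ k, A * Complex.exp (-m) * ((m * z) ^ k / (k.factorial : ℂ)) =
      ∫ x : ℝ, Complex.exp (t * x * Complex.I) ∂(ENNReal.ofReal (poissonWeight m k) • μ k) := by
    intro k
    rw [integral_smul_measure, ← charFun_apply_real, h k,
      ENNReal.toReal_ofReal (poissonWeight_nonneg hm k), poissonWeight, Complex.real_smul]
    push_cast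
    ring
  simp_rw [hk] at h2
  rw [charFun_apply_real, poissonMixture, h1.unique h2, mul_assoc, ← Complex.exp_add]
  congr 2
  ring

lemma withDensity_ofReal_tsum {f : ℕ → ℝ → ℝ} (hf : ∀ k x, 0 ≤ f k x)
    (hm : ∀ k, Measurable (f k)) (h : ∑' k, ∫⁻ x, ENNReal.ofReal (f k x) ≠ ∞) :
    volume.withDensity (fun x => ENNReal.ofReal (∑' k, f k x)) =
      Measure.sum fun k => volume.withDensity fun x => ENNReal.ofReal (f k x) := by
  rw [← withDensity_tsum fun k => (hm k).ennreal_ofReal]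
  rw [← lintegral_tsum fun k => (hm k).ennreal_ofReal.aemeasurable] at h
  refine withDensity_congr_ae ?_
  filter_upwards [ae_lt_top (by fun_prop) h] with x hx
  rw [tsum_apply (Pi.summable.2 fun _ => ENNReal.summable)]
  refine ENNReal.ofReal_tsum_of_nonneg (fun k => hf k x) ?_
  have := ENNReal.summable_toReal hx.ne
  simpa only [ENNReal.toReal_ofReal (hf _ x)] using this

lemma poissonMixture_withDensity {m : ℝ} (hm : 0 ≤ m) {f : ℕ → ℝ → ℝ} (hf : ∀ k x, 0 ≤ f k x)
    (hmeas : ∀ k, Measurable (f k)) (h : ∀ k, ∫⁻ x, ENNReal.ofReal (f k x) = 1) :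
    poissonMixture m (fun k => volume.withDensity fun x => ENNReal.ofReal (f k x)) =
      volume.withDensity fun x => ENNReal.ofReal (∑' k, poissonWeight m k * f k x) := by
  rw [withDensity_ofReal_tsum fun k x => mul_nonneg (poissonWeight_nonneg hm k) (hf k x)]
  · simp_rw [ENNReal.ofReal_mul (poissonWeight_nonneg hm _)]
    unfold poissonMixture
    congr 1 with k : 1
    rw [← withDensity_smul _ (hmeas k).ennreal_ofReal]
    rfl
  · exact fun k => (hmeas k).const_mul _
  · simp_rw [ENNReal.ofReal_mul (poissonWeight_nonneg hm _)]
    simp_rw [lintegral_const_mul _ (hmeas _).ennreal_ofReal, h, mul_one]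
    simp [tsum_ofReal_poissonWeight hm]

lemma integral_gammaMeasure {E : Type*} [NormedAddCommGroup E] [NormedSpace ℝ E] {a b : ℝ}
    (ha : 0 < a) (hb : 0 < b) (f : ℝ → E) :
    ∫ x, f x ∂gammaMeasure a b =
      ∫ x in Set.Ioi 0, (b ^ a / Real.Gamma a * x ^ (a - 1) * Real.exp (-(b * x))) • f x := by
  rw [gammaMeasure, show gammaPDF a b = fun x => ENNReal.ofReal (gammaPDFReal a b x) from rfl,
    integral_withDensity_eq_integral_toReal_smul
    (measurable_gammaPDFReal a b).ennreal_ofReal (ae_of_all _ fun x => ENNReal.ofReal_lt_top),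
    ← setIntegral_eq_integral_of_forall_compl_eq_zero (s := Set.Ici 0),
    integral_Ici_eq_integral_Ioi]
  · refine setIntegral_congr_fun measurableSet_Ioi fun x (hx : 0 < x) => ?_
    simp only [ENNReal.toReal_ofReal (gammaPDFReal_nonneg ha hb x)]
    simp only [gammaPDFReal, if_pos hx.le]
  · intro x hx
    have hx' : ¬ 0 ≤ x := hx
    simp [gammaPDFReal, hx']

lemma mgf_gammaMeasure {a b t : ℝ} (ha : 0 < a) (hb : 0 < b) (ht : t < b) :
    mgf id (gammaMeasure a b) t = (b / (b - t)) ^ a := by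
  have hbt : 0 < b - t := sub_pos.2 ht
  have hΓ := (Real.Gamma_pos_of_pos ha).ne'
  have key := Real.integral_rpow_mul_exp_neg_mul_Ioi ha hbt
  rw [mgf, integral_gammaMeasure ha hb, div_eq_mul_one_div b (b - t),
    Real.mul_rpow hb.le (by positivity)]
  have : b ^ a * (1 / (b - t)) ^ a = b ^ a / Real.Gamma a *
      ∫ x in Set.Ioi 0, x ^ (a - 1) * Real.exp (-((b - t) * x)) := by
    rw [key]; field_simp
  rw [this, ← integral_const_mul]
  refine setIntegral_congr_fun measurableSet_Ioi fun x _ => ?_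
  simp only [id, smul_eq_mul, mul_assoc, ← Real.exp_add]
  congr 4
  ring

lemma Iio_subset_integrableExpSet_gammaMeasure {a b : ℝ} (ha : 0 < a) (hb : 0 < b) :
    Set.Iio b ⊆ integrableExpSet id (gammaMeasure a b) := by
  intro t ht
  have : 0 < b - t := sub_pos.2 ht
  refine not_imp_comm.1 integral_undef ?_
  change mgf id (gammaMeasure a b) t ≠ 0
  rw [mgf_gammaMeasure ha hb ht]
  positivity

lemma complexMGF_gammaMeasure {a b : ℝ} (ha : 0 < a) (hb : 0 < b) {z : ℂ} (hz : z.re < b) :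
    complexMGF id (gammaMeasure a b) z = (b / (b - z)) ^ (a : ℂ) := by
  have hsub : Set.Iio b ⊆ interior (integrableExpSet id (gammaMeasure a b)) :=
    interior_maximal (Iio_subset_integrableExpSet_gammaMeasure ha hb) isOpen_Iio
  have hpos : ∀ w : ℂ, w.re < b → 0 < (b - w).re := fun w hw => by simpa using hw
  have hf : AnalyticOnNhd ℂ (complexMGF id (gammaMeasure a b)) {w | w.re < b} :=
    analyticOnNhd_complexMGF.mono fun w hw => hsub hw
  have hg : AnalyticOnNhd ℂ (fun w : ℂ => (b / (b - w)) ^ (a : ℂ)) {w | w.re < b} := by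
    refine DifferentiableOn.analyticOnNhd (fun w hw => ?_)
      (isOpen_Iio.preimage Complex.continuous_re)
    have hw' := hpos w hw
    have hne : (b - w : ℂ) ≠ 0 := fun h => by simp [h] at hw'
    refine DifferentiableAt.differentiableWithinAt ?_
    refine DifferentiableAt.cpow (by fun_prop (disch := exact hne)) (by fun_prop) (Or.inl ?_)
    rw [div_eq_mul_inv, Complex.re_ofReal_mul, Complex.inv_re]
    exact mul_pos hb (div_pos hw' (Complex.normSq_pos.2 hne))
  refine hf.eqOn_of_preconnected_of_frequently_eq hg
    (convex_halfSpace_re_lt b).isPreconnected (z₀ := 0) (by simpa using hb) ?_ hz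
  have hreal : ∃ᶠ t : ℝ in nhdsWithin 0 {0}ᶜ,
      complexMGF id (gammaMeasure a b) t = (b / (b - t : ℂ)) ^ (a : ℂ) := by
    refine Filter.Eventually.frequently ?_
    filter_upwards [nhdsWithin_le_nhds (Iio_mem_nhds hb)] with t ht
    have : 0 < b - t := sub_pos.2 ht
    rw [complexMGF_ofReal, mgf_gammaMeasure ha hb ht, Complex.ofReal_cpow (by positivity)]
    push_cast
    rfl
  rw [Filter.frequently_iff_seq_forall] at hreal ⊢
  obtain ⟨xs, hx, hxe⟩ := hreal
  refine ⟨fun n => xs n, ?_, hxe⟩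
  rw [tendsto_nhdsWithin_iff] at hx ⊢
  refine ⟨?_, by simpa using hx.2⟩
  have := (Complex.continuous_ofReal.tendsto 0).comp hx.1
  simpa [Function.comp_def] using this
lemma lintegral_gammaMeasure (a b : ℝ) {f : ℝ → ℝ≥0∞} (hf : Measurable f) :
    ∫⁻ x, f x ∂gammaMeasure a b =
      ∫⁻ x in Set.Ioi 0,
        ENNReal.ofReal (b ^ a / Real.Gamma a * x ^ (a - 1) * Real.exp (-(b * x))) * f x := by
  have hm : Measurable (gammaPDF a b) := (measurable_gammaPDFReal a b).ennreal_ofReal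
  rw [gammaMeasure, lintegral_withDensity_eq_lintegral_mul _ hm hf,
    ← setLIntegral_congr (Ioi_ae_eq_Ici (a := (0 : ℝ))).symm,
    ← lintegral_indicator measurableSet_Ici]
  refine lintegral_congr fun x => ?_
  by_cases hx : 0 ≤ x
  · simp [gammaPDF_of_nonneg hx, hx]
  · simp [gammaPDF_of_neg (not_le.1 hx), hx]

/-- The law of `√G * Z`, where `G` is a gamma variable with shape `a` and rate `1 / 8` and `Z` is
an independent standard Gaussian variable. -/
def varianceGamma (a : ℝ) : Measure ℝ :=
  ((gammaMeasure a (1 / 8)).prod (gaussianReal 0 1)).map fun p => √p.1 * p.2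

lemma isProbabilityMeasure_varianceGamma {a : ℝ} (ha : 0 < a) :
    IsProbabilityMeasure (varianceGamma a) := by
  have := isProbabilityMeasure_gammaMeasure ha (r := 1 / 8) (by norm_num)
  exact Measure.isProbabilityMeasure_map (by fun_prop)

lemma charFun_varianceGamma {a : ℝ} (ha : 0 < a) (t : ℝ) :
    charFun (varianceGamma a) t = ((1 / (1 + 4 * t ^ 2) : ℝ) : ℂ) ^ (a : ℂ) := by
  have hb : (0 : ℝ) < 1 / 8 := by norm_num
  have := isProbabilityMeasure_gammaMeasure ha hb
  have hint : Integrable (fun p : ℝ × ℝ => Complex.exp (t * (√p.1 * p.2 : ℝ) * Complex.I))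
      ((gammaMeasure a (1 / 8)).prod (gaussianReal 0 1)) := by
    refine Integrable.of_bound (C := 1) (by fun_prop) (ae_of_all _ fun p => ?_)
    rw [← Complex.ofReal_mul, Complex.norm_exp_ofReal_mul_I]
  have hz : ((-(t ^ 2 / 2) : ℝ) : ℂ).re < 1 / 8 := by
    rw [Complex.ofReal_re]; nlinarith [sq_nonneg t]
  have key := complexMGF_gammaMeasure ha hb hz
  rw [charFun_apply_real, varianceGamma, integral_map (by fun_prop) (by fun_prop),
    integral_prod _ hint]
  have inner : ∀ g : ℝ, ∫ z, Complex.exp (t * (√g * z : ℝ) * Complex.I) ∂gaussianReal 0 1 =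
      Complex.exp (-((√g : ℂ) ^ 2 * t ^ 2 / 2)) := by
    intro g
    have := charFun_gaussianReal (μ := 0) (v := 1) (t * √g)
    rw [charFun_apply_real] at this
    convert this using 2
    · ext z; congr 1; push_cast; ring
    · push_cast; ring_nf
  simp_rw [inner]
  trans complexMGF id (gammaMeasure a (1 / 8)) ((-(t ^ 2 / 2) : ℝ) : ℂ)
  · rw [complexMGF, integral_gammaMeasure ha hb, integral_gammaMeasure ha hb]
    refine setIntegral_congr_fun measurableSet_Ioi fun g (hg : 0 < g) => ?_
    simp only [← Complex.ofReal_pow, Real.sq_sqrt hg.le, id]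
    congr 2
    push_cast
    ring
  · rw [key]
    congr 1
    rw [← Complex.ofReal_sub, ← Complex.ofReal_div]
    congr 1
    have : 1 + 4 * t ^ 2 ≠ 0 := by positivity
    have : 1 / 8 - -(t ^ 2 / 2) ≠ 0 := by nlinarith [sq_nonneg t]
    rw [div_eq_div_iff (by assumption) (by assumption)]
    ring

lemma lintegral_gaussianReal_sqrt_mul {g : ℝ} (hg : 0 < g) {f : ℝ → ℝ≥0∞} (hf : Measurable f) :
    ∫⁻ z, f (√g * z) ∂gaussianReal 0 1 =
      ∫⁻ x, ENNReal.ofReal ((√(2 * π * g))⁻¹ * Real.exp (-x ^ 2 / (2 * g))) * f x := by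
  have hv : NNReal.mk (√g ^ 2) (sq_nonneg _) * 1 = NNReal.mk g hg.le := by
    ext; simp [Real.sq_sqrt hg.le]
  have hv0 : NNReal.mk g hg.le ≠ 0 := fun h => hg.ne' (congrArg NNReal.toReal h)
  have h := gaussianReal_map_const_mul (μ := 0) (v := 1) (√g)
  rw [hv, mul_zero,
    gaussianReal_of_var_ne_zero _ hv0] at h
  rw [← lintegral_map hf (by fun_prop : Measurable fun z => √g * z), h,
    lintegral_withDensity_eq_lintegral_mul _ (measurable_gaussianPDF _ _) hf]
  simp [gaussianPDF, gaussianPDFReal]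

lemma varianceGamma_eq_withDensity_lintegral (a : ℝ) :
    varianceGamma a = volume.withDensity fun x => ∫⁻ g in Set.Ioi 0,
      ENNReal.ofReal ((1 / 8) ^ a / Real.Gamma a * g ^ (a - 1) * Real.exp (-(1 / 8 * g))) *
        ENNReal.ofReal ((√(2 * π * g))⁻¹ * Real.exp (-x ^ 2 / (2 * g))) := by
  refine Measure.ext_of_lintegral _ fun f hf => ?_
  rw [varianceGamma, lintegral_map hf (by fun_prop), lintegral_prod _ (by fun_prop),
    lintegral_gammaMeasure _ _ (by fun_prop),
    lintegral_withDensity_eq_lintegral_mul _ (by fun_prop) hf]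
  have : ∀ x : ℝ, ((fun x => ∫⁻ g in Set.Ioi 0,
      ENNReal.ofReal ((1 / 8) ^ a / Real.Gamma a * g ^ (a - 1) * Real.exp (-(1 / 8 * g))) *
        ENNReal.ofReal ((√(2 * π * g))⁻¹ * Real.exp (-x ^ 2 / (2 * g)))) * f) x =
      ∫⁻ g in Set.Ioi 0,
      ENNReal.ofReal ((1 / 8) ^ a / Real.Gamma a * g ^ (a - 1) * Real.exp (-(1 / 8 * g))) *
        (ENNReal.ofReal ((√(2 * π * g))⁻¹ * Real.exp (-x ^ 2 / (2 * g))) * f x) := by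
    intro x
    simp_rw [← mul_assoc]
    rw [lintegral_mul_const _ (by fun_prop)]
    rfl
  simp_rw [this]
  rw [lintegral_lintegral_swap (by fun_prop)]
  refine setLIntegral_congr_fun measurableSet_Ioi fun g hg => ?_
  rw [lintegral_const_mul _ (by fun_prop), ← lintegral_gaussianReal_sqrt_mul hg hf]

lemma setLIntegral_Ioi_comp_mul_exp {c : ℝ} (hc : 0 < c) (f : ℝ → ℝ≥0∞) :
    ∫⁻ g in Set.Ioi 0, f g = ∫⁻ t, ENNReal.ofReal (c * Real.exp t) * f (c * Real.exp t) := by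
  have himage : (fun t => c * Real.exp t) '' Set.univ = Set.Ioi 0 := by
    ext y
    simp only [Set.image_univ, Set.mem_range, Set.mem_Ioi]
    refine ⟨fun ⟨t, ht⟩ => ht ▸ by positivity, fun hy => ⟨Real.log (y / c), ?_⟩⟩
    rw [Real.exp_log (by positivity)]
    field_simp
  rw [← himage, lintegral_image_eq_lintegral_abs_deriv_mul MeasurableSet.univ
    (fun t _ => ((Real.hasDerivAt_exp t).const_mul c).hasDerivWithinAt)
    (fun s _ t _ h => Real.exp_injective (mul_left_cancel₀ hc.ne' h)), setLIntegral_univ]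
  exact lintegral_congr fun t => by rw [abs_of_pos (by positivity)]

lemma lintegral_eq_setLIntegral_Ioi_add_neg {f : ℝ → ℝ≥0∞} (hf : Measurable f) :
    ∫⁻ t, f t = ∫⁻ t in Set.Ioi 0, f t + f (-t) := by
  rw [lintegral_add_left hf, ← lintegral_add_compl f (measurableSet_Ioi (a := (0 : ℝ))),
    Set.compl_Ioi, ← setLIntegral_congr (Iio_ae_eq_Iic (a := (0 : ℝ)))]
  congr 1
  rw [← (Measure.measurePreserving_neg (volume : Measure ℝ)).setLIntegral_comp_preimage
    measurableSet_Iio hf]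
  simp

lemma lintegral_exp_mul_exp_cosh (ν y : ℝ) :
    ∫⁻ t, ENNReal.ofReal (Real.exp (ν * t) * Real.exp (-y * Real.cosh t)) =
      2 * ∫⁻ t in Set.Ioi 0, ENNReal.ofReal (Real.exp (-y * Real.cosh t) * Real.cosh (ν * t)) := by
  rw [lintegral_eq_setLIntegral_Ioi_add_neg (by fun_prop), ← lintegral_const_mul _ (by fun_prop)]
  refine lintegral_congr fun t => ?_
  rw [← ENNReal.ofReal_add (by positivity) (by positivity), ← ENNReal.ofReal_ofNat,
    ← ENNReal.ofReal_mul zero_le_two, Real.cosh_neg, Real.cosh_eq (ν * t), mul_neg]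
  congr 1
  ring

/-- The density of the variance gamma distribution `varianceGamma a`. -/
def varianceGammaPDFReal (a x : ℝ) : ℝ :=
  (1 / 4) ^ a / (√π * Real.Gamma a) * (|x| ^ (a - 1 / 2) * besselK (a - 1 / 2) (|x| / 2))

lemma gamma_mul_gaussian_density_comp_mul_exp {a x : ℝ} (hx : x ≠ 0) (t : ℝ) :
    2 * |x| * Real.exp t * ((1 / 8) ^ a / Real.Gamma a * (2 * |x| * Real.exp t) ^ (a - 1) *
        Real.exp (-(1 / 8 * (2 * |x| * Real.exp t))) *
        ((√(2 * π * (2 * |x| * Real.exp t)))⁻¹ *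
          Real.exp (-x ^ 2 / (2 * (2 * |x| * Real.exp t))))) =
      (1 / 4) ^ a / (√π * Real.Gamma a) * |x| ^ (a - 1 / 2) / 2 *
        (Real.exp ((a - 1 / 2) * t) * Real.exp (-(|x| / 2) * Real.cosh t)) := by
  have hx' : 0 < |x| := abs_pos.2 hx
  set g := 2 * |x| * Real.exp t with hg
  have hg0 : 0 < g := by positivity
  have h1 : g * (g ^ (a - 1) * (√(2 * π * g))⁻¹) = (√(2 * π))⁻¹ * g ^ (a - 1 / 2) := by
    rw [Real.sqrt_mul (by positivity), mul_inv, Real.sqrt_eq_rpow g, ← Real.rpow_neg hg0.le]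
    have : g ^ (a - 1 / 2) = g ^ (1 : ℝ) * g ^ (a - 1) * g ^ (-(1 / 2) : ℝ) := by
      rw [← Real.rpow_add hg0, ← Real.rpow_add hg0]; congr 1; ring
    rw [this, Real.rpow_one]
    ring
  have h2 : Real.exp (-(1 / 8 * g)) * Real.exp (-x ^ 2 / (2 * g)) =
      Real.exp (-(|x| / 2) * Real.cosh t) := by
    rw [← Real.exp_add, Real.cosh_eq, Real.exp_neg, ← sq_abs x, hg]
    congr 1
    have := Real.exp_pos t
    field_simp
    ring
  have h3 : g ^ (a - 1 / 2) = 2 ^ (a - 1 / 2) * |x| ^ (a - 1 / 2) * Real.exp ((a - 1 / 2) * t) := by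
    rw [hg, Real.mul_rpow (by positivity) (by positivity), Real.mul_rpow (by positivity) hx'.le,
      ← Real.exp_mul, mul_comm t]
  have h4 : (1 / 8 : ℝ) ^ a * ((√(2 * π))⁻¹ * 2 ^ (a - 1 / 2)) = (1 / 4) ^ a / √π / 2 := by
    have h8 : (1 / 8 : ℝ) ^ a = (1 / 4) ^ a * (2 ^ a)⁻¹ := by
      rw [← Real.inv_rpow zero_le_two, ← Real.mul_rpow (by norm_num) (by norm_num)]
      norm_num
    rw [h8, Real.sqrt_mul zero_le_two, Real.rpow_sub two_pos, ← Real.sqrt_eq_rpow]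
    have : (0 : ℝ) < 2 ^ a := by positivity
    have hs : √2 * √2 = (2 : ℝ) := Real.mul_self_sqrt zero_le_two
    have hs0 : 0 < √(2 : ℝ) := by positivity
    have hp : 0 < √π := by positivity
    field_simp
    nlinarith
  calc _ = (1 / 8 : ℝ) ^ a / Real.Gamma a * (g * (g ^ (a - 1) * (√(2 * π * g))⁻¹)) *
        (Real.exp (-(1 / 8 * g)) * Real.exp (-x ^ 2 / (2 * g))) := by ring
    _ = (1 / 8 : ℝ) ^ a * ((√(2 * π))⁻¹ * 2 ^ (a - 1 / 2)) / Real.Gamma a *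
        (|x| ^ (a - 1 / 2) * Real.exp ((a - 1 / 2) * t)) *
        Real.exp (-(|x| / 2) * Real.cosh t) := by rw [h1, h2, h3]; ring
    _ = _ := by rw [h4]; ring

lemma lintegral_gamma_mul_gaussian_density {a x : ℝ} (ha : 0 < a) (hx : x ≠ 0) :
    ∫⁻ g in Set.Ioi 0,
      ENNReal.ofReal ((1 / 8) ^ a / Real.Gamma a * g ^ (a - 1) * Real.exp (-(1 / 8 * g))) *
        ENNReal.ofReal ((√(2 * π * g))⁻¹ * Real.exp (-x ^ 2 / (2 * g))) =
      ENNReal.ofReal ((1 / 4) ^ a / (√π * Real.Gamma a) * |x| ^ (a - 1 / 2)) *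
        ∫⁻ t in Set.Ioi 0, ENNReal.ofReal
          (Real.exp (-(|x| / 2) * Real.cosh t) * Real.cosh ((a - 1 / 2) * t)) := by
  have hx' : 0 < |x| := abs_pos.2 hx
  have hΓ := Real.Gamma_pos_of_pos ha
  have h2 : ENNReal.ofReal ((1 / 4) ^ a / (√π * Real.Gamma a) * |x| ^ (a - 1 / 2)) =
      ENNReal.ofReal ((1 / 4) ^ a / (√π * Real.Gamma a) * |x| ^ (a - 1 / 2) / 2) * 2 := by
    rw [← ENNReal.ofReal_ofNat 2, ← ENNReal.ofReal_mul (by positivity)]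
    congr 1
    ring
  rw [h2, mul_assoc, ← lintegral_exp_mul_exp_cosh, ← lintegral_const_mul _ (by fun_prop),
    setLIntegral_Ioi_comp_mul_exp (c := 2 * |x|) (by positivity)]
  refine lintegral_congr fun t => ?_
  rw [← ENNReal.ofReal_mul (by positivity), ← ENNReal.ofReal_mul (by positivity),
    ← ENNReal.ofReal_mul (by positivity), gamma_mul_gaussian_density_comp_mul_exp hx]

lemma measurable_besselK (ν : ℝ) : Measurable (besselK ν) := by
  have : StronglyMeasurable (Function.uncurry fun x t : ℝ =>
      Real.exp (-x * Real.cosh t) * Real.cosh (ν * t)) :=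
    (by fun_prop : Continuous _).stronglyMeasurable
  exact this.integral_prod_right.measurable

lemma besselK_nonneg (ν x : ℝ) : 0 ≤ besselK ν x :=
  integral_nonneg fun t => by have := Real.cosh_pos (ν * t); positivity

lemma varianceGammaPDFReal_nonneg {a : ℝ} (ha : 0 < a) (x : ℝ) :
    0 ≤ varianceGammaPDFReal a x := by
  have := besselK_nonneg (a - 1 / 2) (|x| / 2)
  unfold varianceGammaPDFReal
  positivity

lemma measurable_varianceGammaPDFReal (a : ℝ) : Measurable (varianceGammaPDFReal a) := by
  have := measurable_besselK (a - 1 / 2)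
  unfold varianceGammaPDFReal
  fun_prop

lemma ofReal_besselK {ν x : ℝ} (h : ∫⁻ t in Set.Ioi 0,
      ENNReal.ofReal (Real.exp (-x * Real.cosh t) * Real.cosh (ν * t)) ≠ ∞) :
    ENNReal.ofReal (besselK ν x) = ∫⁻ t in Set.Ioi 0,
      ENNReal.ofReal (Real.exp (-x * Real.cosh t) * Real.cosh (ν * t)) := by
  rw [besselK, integral_eq_lintegral_of_nonneg_ae, ENNReal.ofReal_toReal h]
  · exact ae_of_all _ fun t => by have := Real.cosh_pos (ν * t); simp only [Pi.zero_apply]; positivity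
  · exact (by fun_prop : Continuous _).aestronglyMeasurable

lemma varianceGamma_eq_withDensity {a : ℝ} (ha : 0 < a) :
    varianceGamma a = volume.withDensity fun x => ENNReal.ofReal (varianceGammaPDFReal a x) := by
  have := isProbabilityMeasure_varianceGamma ha
  have hfin : ∫⁻ x, ∫⁻ g in Set.Ioi 0,
      ENNReal.ofReal ((1 / 8) ^ a / Real.Gamma a * g ^ (a - 1) * Real.exp (-(1 / 8 * g))) *
        ENNReal.ofReal ((√(2 * π * g))⁻¹ * Real.exp (-x ^ 2 / (2 * g))) ≠ ∞ := by
    have := measure_ne_top (varianceGamma a) Set.univ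
    rwa [varianceGamma_eq_withDensity_lintegral, withDensity_apply _ MeasurableSet.univ,
      setLIntegral_univ] at this
  rw [varianceGamma_eq_withDensity_lintegral]
  refine withDensity_congr_ae ?_
  filter_upwards [ae_lt_top (by fun_prop) hfin, Measure.ae_ne volume 0] with x hx hx0
  have hΓ := Real.Gamma_pos_of_pos ha
  have hx' : 0 < |x| := abs_pos.2 hx0
  have hc : 0 < (1 / 4) ^ a / (√π * Real.Gamma a) * |x| ^ (a - 1 / 2) := by positivity
  rw [lintegral_gamma_mul_gaussian_density ha hx0] at hx ⊢
  rw [varianceGammaPDFReal, ← mul_assoc, ENNReal.ofReal_mul hc.le, ofReal_besselK]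
  intro htop
  rw [htop, ENNReal.mul_top (ENNReal.ofReal_pos.2 hc).ne'] at hx
  exact hx.ne rfl

lemma poissonWeight_zero (k : ℕ) : poissonWeight 0 k = if k = 0 then 1 else 0 := by
  rcases k with _ | k <;> simp [poissonWeight]

lemma ncChiSqPdf_eq_tsum {r lam x : ℝ} (hr : 0 < r) (hlam : 0 ≤ lam) (hx : x ≠ 0) :
    ncChiSqPdf r lam x =
      ∑' k : ℕ, poissonWeight (lam / 2) k * gammaPDFReal (r / 2 + k) (1 / 2) x := by
  rcases hx.lt_or_gt with hx | hx
  · simp [ncChiSqPdf, gammaPDFReal, hx.le, hx.not_ge]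
  rcases hlam.eq_or_lt with rfl | hlam
  · rw [tsum_eq_single 0 fun k hk => by simp [poissonWeight_zero, hk]]
    simp only [ncChiSqPdf, hx.not_ge, gammaPDFReal, hx.le, if_true, if_false, zero_div,
      poissonWeight_zero, Nat.cast_zero, add_zero, one_mul]
    rw [Real.div_rpow zero_le_one zero_le_two, Real.one_rpow]
    field_simp
  · simp only [ncChiSqPdf, hx.not_ge, gammaPDFReal, hx.le, hlam.ne', if_true, if_false, besselI]
    rw [← tsum_mul_left]
    congr 1 with k
    have hG := (Real.Gamma_pos_of_pos (by positivity : 0 < r / 2 + k)).ne'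
    have harg : (k : ℝ) + (r / 2 - 1) + 1 = r / 2 + k := by ring
    have hpow : (x / lam) ^ (r / 4 - 1 / 2) * (√(lam * x) / 2) ^ (2 * (k : ℝ) + (r / 2 - 1)) =
        Real.exp (Real.log 2) * lam ^ k * (1 / 2 : ℝ) ^ k * (1 / 2 : ℝ) ^ (r / 2 + k) *
          x ^ (r / 2 + k - 1) := by
      have hl : ∀ y : ℝ, 0 < y → ∀ c, y ^ c = Real.exp (Real.log y * c) :=
        fun y hy c => Real.rpow_def_of_pos hy c
      simp only [← Real.rpow_natCast]
      rw [hl _ (by positivity), hl _ (by positivity), hl _ hlam, hl _ (by positivity),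
        hl (1 / 2) (by positivity), hl x hx, Real.log_div hx.ne' hlam.ne',
        Real.log_div (by positivity) (by norm_num), Real.log_sqrt (by positivity),
        Real.log_mul hlam.ne' hx.ne', one_div, Real.log_inv]
      simp only [← Real.exp_add]
      congr 1
      ring
    have hexp : Real.exp (-(x + lam) / 2) = Real.exp (-(lam / 2)) * Real.exp (-(1 / 2 * x)) := by
      rw [← Real.exp_add]; congr 1; ring
    rw [harg, hexp, poissonWeight, div_eq_mul_one_div lam 2, mul_pow, mul_div_assoc',
      mul_assoc (1 / 2 * _), hpow, Real.exp_log zero_lt_two]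
    field_simp

lemma ncChiSq_eq_poissonMixture {r lam : ℝ} (hr : 0 < r) (hlam : 0 ≤ lam) :
    ncChiSq r lam = poissonMixture (lam / 2) fun k => gammaMeasure (r / 2 + k) (1 / 2) := by
  have ha : ∀ k : ℕ, 0 < r / 2 + k := fun k => by positivity
  refine Eq.trans ?_ (poissonMixture_withDensity (by positivity)
    (f := fun k x => gammaPDFReal (r / 2 + k) (1 / 2) x)
    (fun k x => gammaPDFReal_nonneg (ha k) one_half_pos x)
    (fun k => measurable_gammaPDFReal _ _)
    (fun k => lintegral_gammaPDF_eq_one (ha k) one_half_pos)).symm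
  refine withDensity_congr_ae ?_
  filter_upwards [Measure.ae_ne volume 0] with x hx
  rw [ncChiSqPdf_eq_tsum hr hlam hx]

lemma isProbabilityMeasure_ncChiSq {r lam : ℝ} (hr : 0 < r) (hlam : 0 ≤ lam) :
    IsProbabilityMeasure (ncChiSq r lam) := by
  rw [ncChiSq_eq_poissonMixture hr hlam]
  exact isProbabilityMeasure_poissonMixture (by positivity) fun k =>
    isProbabilityMeasure_gammaMeasure (by positivity) one_half_pos

lemma charFun_ncChiSq {r lam : ℝ} (hr : 0 < r) (hlam : 0 ≤ lam) (t : ℝ) :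
    charFun (ncChiSq r lam) t = (1 / (1 - 2 * t * Complex.I)) ^ ((r / 2 : ℝ) : ℂ) *
      Complex.exp (lam / 2 * (1 / (1 - 2 * t * Complex.I) - 1)) := by
  have h0 : (1 - 2 * t * Complex.I : ℂ) ≠ 0 := fun h => by
    simpa using congrArg Complex.re h
  rw [ncChiSq_eq_poissonMixture hr hlam,
    charFun_poissonMixture (z := 1 / (1 - 2 * t * Complex.I)) (by positivity) fun k =>
      isProbabilityMeasure_gammaMeasure (by positivity) one_half_pos]
  · push_cast; rfl
  intro k
  rw [← complexMGF_id_mul_I, complexMGF_gammaMeasure (by positivity) one_half_pos (by simp)]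
  push_cast
  rw [show (1 / 2 / (1 / 2 - t * Complex.I) : ℂ) = 1 / (1 - 2 * t * Complex.I) by
    rw [div_div, mul_sub]; congr 1; ring,
    Complex.cpow_add _ _ (one_div_ne_zero h0), Complex.cpow_natCast]

lemma charFun_map_sub_prod (μ : Measure ℝ) [IsProbabilityMeasure μ] (t : ℝ) :
    charFun ((μ.prod μ).map fun p => p.1 - p.2) t = ((‖charFun μ t‖ ^ 2 : ℝ) : ℂ) := by
  rw [Complex.ofReal_pow, ← Complex.mul_conj', ← charFun_neg, charFun_apply_real,
    charFun_apply_real, charFun_apply_real, integral_map (by fun_prop) (by fun_prop),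
    ← integral_prod_mul]
  congr 1 with p
  rw [← Complex.exp_add]
  push_cast
  ring_nf

lemma charFun_ncChiSqDiff {r lam : ℝ} (hr : 0 < r) (hlam : 0 ≤ lam) (t : ℝ) :
    charFun (ncChiSqDiff r lam lam) t = ((1 / (1 + 4 * t ^ 2) : ℝ) : ℂ) ^ ((r / 2 : ℝ) : ℂ) *
      Complex.exp (lam * ((1 / (1 + 4 * t ^ 2) : ℝ) - 1)) := by
  have := isProbabilityMeasure_ncChiSq hr hlam
  have hw : (0 : ℝ) ≤ 1 / (1 + 4 * t ^ 2) := by positivity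
  have hsq : Complex.normSq (1 - 2 * t * Complex.I) = 1 + 4 * t ^ 2 := by
    simp [Complex.normSq_apply]; ring
  have hre : (1 / (1 - 2 * t * Complex.I)).re = 1 / (1 + 4 * t ^ 2) := by
    rw [one_div, Complex.inv_re, hsq]; simp
  have hnorm : ‖1 / (1 - 2 * t * Complex.I)‖ ^ 2 = 1 / (1 + 4 * t ^ 2) := by
    rw [← Complex.normSq_eq_norm_sq, map_div₀, hsq, map_one]
  rw [ncChiSqDiff, charFun_map_sub_prod, charFun_ncChiSq hr hlam, norm_mul, Complex.norm_cpow_real,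
    Complex.norm_exp, mul_pow, Real.rpow_pow_comm (norm_nonneg _), hnorm,
    ← Complex.ofReal_cpow hw, ← Real.exp_nat_mul, ← Complex.ofReal_one, ← Complex.ofReal_sub,
    ← Complex.ofReal_mul, ← Complex.ofReal_exp, ← Complex.ofReal_mul]
  congr 3
  rw [show (lam / 2 : ℂ) = (lam / 2 : ℝ) by push_cast; rfl, Complex.re_ofReal_mul,
    Complex.sub_re, Complex.ofReal_one, hre, Complex.one_re]
  push_cast
  ring

lemma ncChiSqDiff_eq_poissonMixture {r lam : ℝ} (hr : 0 < r) (hlam : 0 ≤ lam) :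
    ncChiSqDiff r lam lam = poissonMixture lam fun k => varianceGamma (r / 2 + k) := by
  have hV : ∀ k : ℕ, IsProbabilityMeasure (varianceGamma (r / 2 + k)) := fun k =>
    isProbabilityMeasure_varianceGamma (by positivity)
  have := isProbabilityMeasure_ncChiSq hr hlam
  have := isProbabilityMeasure_poissonMixture hlam hV
  have : IsProbabilityMeasure (ncChiSqDiff r lam lam) :=
    Measure.isProbabilityMeasure_map (by fun_prop)
  refine Measure.ext_of_charFun (funext fun t => ?_)
  rw [charFun_ncChiSqDiff hr hlam, charFun_poissonMixture hlam hV]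
  intro k
  have hw : ((1 / (1 + 4 * t ^ 2) : ℝ) : ℂ) ≠ 0 :=
    Complex.ofReal_ne_zero.2 (by positivity)
  rw [charFun_varianceGamma (by positivity), ← Complex.cpow_natCast, ← Complex.cpow_add _ _ hw]
  push_cast
  rfl

end NcChiSq

/-- Let `T = V₁ - V₂` with `V₁ ~ χ'²_r(λ)` and `V₂ ~ χ'²_r(λ)` independent,
`r > 0`, `λ ≥ 0` (equal noncentrality parameters). Then `T` has probability density function
`p_T(x) = (1/(2^r √π)) e^{-λ} ∑_{k=0}^∞ ((λ/4)^k/(k! Γ(r/2+k))) |x|^{(r-1)/2+k}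
K_{(r-1)/2+k}(|x|/2)`. -/
theorem ncChiSqDiff_pdf_equal_noncentrality (r lam : ℝ) (hr : 0 < r) (hlam : 0 ≤ lam) :
    ncChiSqDiff r lam lam =
      volume.withDensity fun x => ENNReal.ofReal
        (1 / (2 ^ r * Real.sqrt π) * Real.exp (-lam) *
          ∑' k : ℕ, (lam / 4) ^ k / ((k.factorial : ℝ) * Real.Gamma (r / 2 + (k : ℝ))) *
            |x| ^ ((r - 1) / 2 + (k : ℝ)) * besselK ((r - 1) / 2 + (k : ℝ)) (|x| / 2)) := by
  have ha : ∀ k : ℕ, 0 < r / 2 + k := fun k => by positivity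
  rw [NcChiSq.ncChiSqDiff_eq_poissonMixture hr hlam]
  simp_rw [NcChiSq.varianceGamma_eq_withDensity (ha _)]
  rw [NcChiSq.poissonMixture_withDensity hlam
    (fun k => NcChiSq.varianceGammaPDFReal_nonneg (ha k))
    fun k => NcChiSq.measurable_varianceGammaPDFReal _]
  · congr 1 with x
    rw [← tsum_mul_left]
    congr 2 with k
    have hexp : r / 2 + k - 1 / 2 = (r - 1) / 2 + k := by ring
    have hpow : (1 / 4 : ℝ) ^ (r / 2 + k) = (1 / 2 ^ r) * (1 / 4) ^ k := by
      rw [Real.rpow_add (by norm_num), Real.rpow_natCast,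
        show (1 / 4 : ℝ) = (1 / 2) ^ (2 : ℝ) by norm_num, ← Real.rpow_mul (by norm_num),
        mul_div_cancel₀ _ two_ne_zero, Real.div_rpow zero_le_one zero_le_two, Real.one_rpow]
    rw [NcChiSq.poissonWeight, NcChiSq.varianceGammaPDFReal, hexp, hpow,
      div_eq_mul_one_div lam 4, mul_pow]
    ring
  · intro k
    have := NcChiSq.isProbabilityMeasure_varianceGamma (ha k)
    rw [← setLIntegral_univ, ← withDensity_apply _ MeasurableSet.univ,
      ← NcChiSq.varianceGamma_eq_withDensity (ha k), measure_univ]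

end
end

section
/- Let T = V₁ − V₂, where V₁ and V₂ are independent, each following the (central) chi-square distribution χ'²_r(0) with r > 0 degrees of freedom. Then T has a probability density function given, for x ≠ 0, by p_T(x) = (1/(2^r √π Γ(r/2))) |x|^{(r−1)/2} K_{(r−1)/2}(|x|/2), the density of a symmetric variance-gamma random variable. -/
open MeasureTheory ProbabilityTheory Real

noncomputable section

/-- Measures on `ℝ` with the same two-sided Laplace transform, finite near `0`, coincide. -/
lemma ext_of_lintegral_exp_mul_eq {μ ν : Measure ℝ} [IsProbabilityMeasure μ]
    (h : ∀ t : ℝ, ∫⁻ x, ENNReal.ofReal (rexp (t * x)) ∂μ = ∫⁻ x, ENNReal.ofReal (rexp (t * x)) ∂ν)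
    {ε : ℝ} (hε : 0 < ε)
    (hfin : ∀ t : ℝ, |t| < ε → ∫⁻ x, ENNReal.ofReal (rexp (t * x)) ∂μ ≠ ⊤) :
    μ = ν := by
  have hν : IsProbabilityMeasure ν := ⟨by simpa using (h 0).symm⟩
  have hmgf : mgf id μ = mgf id ν := by
    ext t
    simp only [mgf, id_eq]
    rw [integral_eq_lintegral_of_nonneg_ae (ae_of_all _ fun x => (Real.exp_pos _).le)
      (by fun_prop), integral_eq_lintegral_of_nonneg_ae
      (ae_of_all _ fun x => (Real.exp_pos _).le) (by fun_prop), h]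
  have hint : (0 : ℝ) ∈ interior (integrableExpSet id μ) := by
    refine mem_interior.2 ⟨Metric.ball 0 ε, fun t ht => ?_, Metric.isOpen_ball, by simpa⟩
    refine (lintegral_ofReal_ne_top_iff_integrable (by fun_prop)
      (ae_of_all _ fun x => (Real.exp_pos _).le)).1 (hfin t ?_)
    simpa using ht
  refine Measure.ext_of_charFun (funext fun t => ?_)
  rw [← complexMGF_id_mul_I, ← complexMGF_id_mul_I]
  exact eqOn_complexMGF_of_mgf hmgf (by simpa using hint)

lemma lintegral_exp_mul_gammaMeasure {a b : ℝ} (ha : 0 < a) (hb : 0 < b) (s : ℝ) :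
    ∫⁻ x, ENNReal.ofReal (rexp (s * x)) ∂gammaMeasure a b =
      if s < b then ENNReal.ofReal ((b / (b - s)) ^ a) else ⊤ := by
  have hm (c : ℝ) : Measurable (gammaPDF a c) := (measurable_gammaPDFReal a c).ennreal_ofReal
  rw [gammaMeasure, lintegral_withDensity_eq_lintegral_mul _ (hm b) (by fun_prop)]
  simp only [Pi.mul_apply]
  have hΓ := Real.Gamma_pos_of_pos ha
  split_ifs with hs
  · have hbs : 0 < b - s := sub_pos.2 hs
    have key (x : ℝ) : gammaPDF a b x * ENNReal.ofReal (rexp (s * x)) =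
        ENNReal.ofReal ((b / (b - s)) ^ a) * gammaPDF a (b - s) x := by
      rcases lt_or_ge x 0 with hx | hx
      · simp [gammaPDF_of_neg hx]
      · rw [gammaPDF_of_nonneg hx, gammaPDF_of_nonneg hx, ← ENNReal.ofReal_mul (by positivity),
          ← ENNReal.ofReal_mul (by positivity), mul_assoc, ← Real.exp_add,
          Real.div_rpow hb.le hbs.le]
        have : (b - s) ^ a ≠ 0 := (Real.rpow_pos_of_pos hbs a).ne'
        congr 1
        rw [show -(b * x) + s * x = -((b - s) * x) by ring]
        field_simp
    simp_rw [key]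
    rw [lintegral_const_mul _ (hm (b - s)),
      lintegral_gammaPDF_eq_one ha hbs, mul_one]
  · have hbs : b ≤ s := not_lt.1 hs
    by_contra hfin
    have hle : ∫⁻ x in Set.Ioi (1 : ℝ), ENNReal.ofReal (b ^ a / Real.Gamma a * x⁻¹) ≤
        ∫⁻ x, gammaPDF a b x * ENNReal.ofReal (rexp (s * x)) := by
      refine (setLIntegral_mono' measurableSet_Ioi fun x hx => ?_).trans
        (setLIntegral_le_lintegral (Set.Ioi (1 : ℝ)) _)
      have hx1 : (1 : ℝ) < x := hx
      have hx0 : 0 < x := one_pos.trans hx1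
      rw [gammaPDF_of_nonneg hx0.le, ← ENNReal.ofReal_mul (by positivity), mul_assoc,
        ← Real.exp_add, mul_assoc]
      refine ENNReal.ofReal_le_ofReal ?_
      gcongr
      calc x⁻¹ = x ^ (-1 : ℝ) := (Real.rpow_neg_one x).symm
        _ ≤ x ^ (a - 1) := Real.rpow_le_rpow_of_exponent_le hx1.le (by linarith)
        _ ≤ _ := le_mul_of_one_le_right (by positivity) (Real.one_le_exp (by nlinarith))
    have hint : IntegrableOn (fun x : ℝ => b ^ a / Real.Gamma a * x⁻¹) (Set.Ioi 1) := by
      refine (lintegral_ofReal_ne_top_iff_integrable (by fun_prop) ?_).1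
        (ne_top_of_le_ne_top hfin hle)
      filter_upwards [ae_restrict_mem measurableSet_Ioi] with x hx
      have : (0 : ℝ) < x := one_pos.trans hx
      simp only [Pi.zero_apply]
      positivity
    refine not_integrableOn_Ioi_inv (a := 1) ?_
    have hc : b ^ a / Real.Gamma a ≠ 0 := by positivity
    refine (hint.const_mul (b ^ a / Real.Gamma a)⁻¹).congr (ae_of_all _ fun x => ?_)
    simp only
    field_simp

lemma integrable_exp_neg_mul_cosh_add {z : ℝ} (hz : 0 < z) (ν : ℝ) :
    Integrable fun s : ℝ => rexp (-z * Real.cosh s + ν * s) := by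
  have hq : Integrable fun s : ℝ => rexp (-(z / 4) * s ^ 2 + ν * s) := by
    have := (integrable_cexp_quadratic (b := ((z / 4 : ℝ) : ℂ)) (by simpa using hz) ν 0).norm
    refine this.congr (ae_of_all _ fun s => ?_)
    simp only [Complex.norm_exp]
    congr 1
    norm_cast
    simp
  refine hq.mono' (by fun_prop) (ae_of_all _ fun s => ?_)
  rw [Real.norm_of_nonneg (Real.exp_pos _).le, Real.exp_le_exp]
  have h1 : s ^ 2 / 4 ≤ Real.cosh s := by
    rw [← Real.cosh_abs, Real.cosh_eq]
    have := Real.quadratic_le_exp_of_nonneg (abs_nonneg s)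
    have := Real.exp_pos (-|s|)
    nlinarith [sq_abs s, abs_nonneg s]
  nlinarith

lemma integral_exp_neg_mul_cosh_add {z : ℝ} (hz : 0 < z) (ν : ℝ) :
    ∫ s : ℝ, rexp (-z * Real.cosh s + ν * s) = 2 * besselK ν z := by
  have hneg : ∫ s : ℝ, rexp (-z * Real.cosh s + -ν * s) =
      ∫ s : ℝ, rexp (-z * Real.cosh s + ν * s) := by
    rw [← integral_neg_eq_self]
    simp
  have hsum := integral_add (integrable_exp_neg_mul_cosh_add hz ν)
    (integrable_exp_neg_mul_cosh_add hz (-ν))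
  have hcosh : ∫ s : ℝ, rexp (-z * Real.cosh s) * Real.cosh (ν * s) = 2 * besselK ν z := by
    rw [besselK, ← integral_comp_abs]
    refine integral_congr_ae (ae_of_all _ fun s => ?_)
    simp only [Real.cosh_abs]
    rw [← Real.cosh_abs (ν * |s|), abs_mul, abs_abs, ← abs_mul, Real.cosh_abs]
  have h2 : ∫ s : ℝ, (rexp (-z * Real.cosh s + ν * s) + rexp (-z * Real.cosh s + -ν * s)) =
      2 * (2 * besselK ν z) := by
    rw [← hcosh, ← integral_const_mul]
    refine integral_congr_ae (ae_of_all _ fun s => ?_)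
    simp only [Real.exp_add, Real.cosh_eq (ν * s), neg_mul]
    ring
  linarith

lemma ncChiSq_zero_eq_gammaMeasure (r : ℝ) : ncChiSq r 0 = gammaMeasure (r / 2) (1 / 2) := by
  refine withDensity_congr_ae ?_
  have h0 : ∀ᵐ x : ℝ, x ≠ 0 := by simp [ae_iff]
  filter_upwards [h0] with x hx
  rcases lt_or_gt_of_ne hx with hx | hx
  · simp [ncChiSqPdf, hx.le, gammaPDF_of_neg hx]
  · rw [gammaPDF_of_nonneg hx.le, ncChiSqPdf, if_neg hx.not_ge, if_pos rfl]
    rw [Real.div_rpow zero_le_one zero_le_two, Real.one_rpow]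
    congr 1
    rw [show -(1 / 2 * x) = -x / 2 by ring]
    field_simp

lemma lintegral_exp_mul_map_sub {μ ν : Measure ℝ} [SFinite μ] [SFinite ν] (t : ℝ) :
    ∫⁻ x, ENNReal.ofReal (rexp (t * x)) ∂(μ.prod ν).map (fun p : ℝ × ℝ => p.1 - p.2) =
      (∫⁻ x, ENNReal.ofReal (rexp (t * x)) ∂μ) * ∫⁻ x, ENNReal.ofReal (rexp (-t * x)) ∂ν := by
  rw [lintegral_map (by fun_prop) (by fun_prop), ← lintegral_prod_mul (by fun_prop) (by fun_prop)]
  refine lintegral_congr fun p => ?_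
  rw [← ENNReal.ofReal_mul (Real.exp_pos _).le, ← Real.exp_add]
  ring_nf

lemma lintegral_exp_mul_gaussianReal (m t : ℝ) (v : NNReal) :
    ∫⁻ x, ENNReal.ofReal (rexp (t * x)) ∂gaussianReal m v =
      ENNReal.ofReal (rexp (m * t + v * t ^ 2 / 2)) := by
  rw [← ofReal_integral_eq_lintegral_ofReal (integrable_exp_mul_gaussianReal t)
    (ae_of_all _ fun x => (Real.exp_pos _).le)]
  congr 1
  exact mgf_gaussianReal (X := id) (by simp) t

/-- The density of a centred Gaussian variable whose variance is an independent gamma variable of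
shape `a` and rate `b`. -/
def gammaGaussianPdf (a b x : ℝ) : ENNReal :=
  ∫⁻ w, gammaPDF a b w * gaussianPDF 0 w.toNNReal x

lemma measurable_gammaPDF_mul_gaussianPDF (a b : ℝ) :
    Measurable fun p : ℝ × ℝ => gammaPDF a b p.1 * gaussianPDF 0 p.1.toNNReal p.2 := by
  unfold gammaPDF gaussianPDF gaussianPDFReal
  fun_prop

lemma measurable_gammaGaussianPdf (a b : ℝ) : Measurable (gammaGaussianPdf a b) :=
  (measurable_gammaPDF_mul_gaussianPDF a b).lintegral_prod_left'

lemma lintegral_exp_mul_gammaGaussianPdf (a b t : ℝ) :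
    ∫⁻ x, ENNReal.ofReal (rexp (t * x)) ∂volume.withDensity (gammaGaussianPdf a b) =
      ∫⁻ w, ENNReal.ofReal (rexp (t ^ 2 / 2 * w)) ∂gammaMeasure a b := by
  have hm : Measurable (gammaPDF a b) := (measurable_gammaPDFReal a b).ennreal_ofReal
  have hmeas := measurable_gammaPDF_mul_gaussianPDF a b
  rw [lintegral_withDensity_eq_lintegral_mul _ (measurable_gammaGaussianPdf a b) (by fun_prop),
    gammaMeasure, lintegral_withDensity_eq_lintegral_mul _ hm (by fun_prop)]
  simp only [Pi.mul_apply, gammaGaussianPdf]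
  calc ∫⁻ x, (∫⁻ w, gammaPDF a b w * gaussianPDF 0 w.toNNReal x) * ENNReal.ofReal (rexp (t * x))
      = ∫⁻ x, ∫⁻ w, gammaPDF a b w * gaussianPDF 0 w.toNNReal x *
          ENNReal.ofReal (rexp (t * x)) := by
        refine lintegral_congr fun x => (lintegral_mul_const _ ?_).symm
        exact hmeas.comp (measurable_id.prodMk measurable_const)
    _ = ∫⁻ w, ∫⁻ x, gammaPDF a b w * gaussianPDF 0 w.toNNReal x *
          ENNReal.ofReal (rexp (t * x)) := by
        refine lintegral_lintegral_swap (Measurable.aemeasurable ?_)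
        exact (hmeas.comp measurable_swap).mul (by fun_prop)
    _ = _ := by
        have h0 : ∀ᵐ w : ℝ, w ≠ 0 := by simp [ae_iff]
        refine lintegral_congr_ae ?_
        filter_upwards [h0] with w hw
        rcases lt_or_gt_of_ne hw with hw | hw
        · simp [gammaPDF_of_neg hw]
        · have hv : w.toNNReal ≠ 0 := by simpa using hw
          have := lintegral_exp_mul_gaussianReal 0 t w.toNNReal
          rw [gaussianReal_of_var_ne_zero _ hv, lintegral_withDensity_eq_lintegral_mul _
            (measurable_gaussianPDF _ _) (by fun_prop)] at this
          simp only [Pi.mul_apply] at this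
          simp_rw [mul_assoc]
          rw [lintegral_const_mul' (gammaPDF a b w) _ ENNReal.ofReal_ne_top, this,
            Real.coe_toNNReal _ hw.le]
          ring_nf

lemma gammaGaussianPdf_eq_besselK {a b x : ℝ} (ha : 0 < a) (hb : 0 < b) (hx : x ≠ 0) :
    gammaGaussianPdf a b x = ENNReal.ofReal (b ^ a / Real.Gamma a * (√(2 * π))⁻¹ *
      (|x| / √(2 * b)) ^ (a - 1 / 2) * (2 * besselK (a - 1 / 2) (√(2 * b) * |x|))) := by
  have hx0 : 0 < |x| := abs_pos.2 hx
  have hΓ := Real.Gamma_pos_of_pos ha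
  set β := √(2 * b) with hβ
  have hβ0 : 0 < β := by positivity
  have hβ2 : β ^ 2 = 2 * b := Real.sq_sqrt (by positivity)
  set c := |x| / β with hc
  have hc0 : 0 < c := by positivity
  have himage : (fun s : ℝ => c * rexp s) '' Set.univ = Set.Ioi 0 := by
    ext w
    simp only [Set.image_univ, Set.mem_range, Set.mem_Ioi]
    constructor
    · rintro ⟨s, rfl⟩
      positivity
    · intro hw
      refine ⟨Real.log (w / c), ?_⟩
      rw [Real.exp_log (by positivity)]
      field_simp
  have hpos : gammaGaussianPdf a b x =
      ∫⁻ w in Set.Ioi 0, gammaPDF a b w * gaussianPDF 0 w.toNNReal x := by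
    rw [gammaGaussianPdf, setLIntegral_eq_of_support_subset]
    intro w hw
    by_contra hw0
    rcases (not_lt.1 (Set.mem_Ioi.not.1 hw0)).lt_or_eq with h | h
    · exact hw (by simp [gammaPDF_of_neg h])
    · exact hw (by simp [h])
  rw [hpos, ← himage, lintegral_image_eq_lintegral_abs_deriv_mul MeasurableSet.univ
    (fun s _ => ((Real.hasDerivAt_exp s).const_mul c).hasDerivWithinAt)
    (fun s _ u _ h => Real.exp_injective (mul_left_cancel₀ hc0.ne' h)),
    ← integral_exp_neg_mul_cosh_add (by positivity), ← integral_const_mul,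
    ofReal_integral_eq_lintegral_ofReal
      ((integrable_exp_neg_mul_cosh_add (by positivity) _).const_mul _)
      (ae_of_all _ fun s => by positivity), Measure.restrict_univ]
  refine lintegral_congr fun s => ?_
  have hw : 0 < c * rexp s := by positivity
  rw [gammaPDF_of_nonneg hw.le, gaussianPDF, gaussianPDFReal, Real.coe_toNNReal _ hw.le,
    ← ENNReal.ofReal_mul (by positivity), ← ENNReal.ofReal_mul (by positivity), abs_of_pos hw]
  congr 1
  have hexp : -(b * (c * rexp s)) + -(x - 0) ^ 2 / (2 * (c * rexp s)) =
      -(β * |x|) * Real.cosh s := by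
    have hxc : |x| = c * β := by rw [hc]; field_simp
    rw [Real.cosh_eq, sub_zero, ← sq_abs x, hxc, Real.exp_neg, show b = β ^ 2 / 2 by linarith]
    field_simp
    ring
  rw [Real.exp_add, ← hexp, Real.exp_add, mul_comm (a - 1 / 2) s, Real.exp_mul,
    Real.sqrt_mul (by positivity : 0 ≤ 2 * π), Real.sqrt_eq_rpow (c * rexp s)]
  have hpow : c * rexp s * ((c * rexp s) ^ (a - 1) * ((c * rexp s) ^ (1 / 2 : ℝ))⁻¹) =
      c ^ (a - 1 / 2) * rexp s ^ (a - 1 / 2) := by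
    rw [← Real.mul_rpow hc0.le (Real.exp_pos s).le, ← Real.rpow_neg hw.le,
      show a - 1 / 2 = 1 + (a - 1) + -(1 / 2) by ring, Real.rpow_add hw, Real.rpow_add hw,
      Real.rpow_one]
    ring
  rw [mul_inv]
  linear_combination (b ^ a / Real.Gamma a * (√(2 * π))⁻¹ * rexp (-(b * (c * rexp s))) *
    rexp (-(x - 0) ^ 2 / (2 * (c * rexp s)))) * hpow

lemma lintegral_exp_mul_ncChiSqDiff_zero {r : ℝ} (hr : 0 < r) (t : ℝ) :
    ∫⁻ x, ENNReal.ofReal (rexp (t * x)) ∂ncChiSqDiff r 0 0 =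
      if t ^ 2 / 2 < 1 / 8 then ENNReal.ofReal ((1 / 8 / (1 / 8 - t ^ 2 / 2)) ^ (r / 2)) else ⊤ := by
  have ha : 0 < r / 2 := by positivity
  have := isProbabilityMeasure_gammaMeasure ha one_half_pos
  rw [ncChiSqDiff, ncChiSq_zero_eq_gammaMeasure, lintegral_exp_mul_map_sub,
    lintegral_exp_mul_gammaMeasure ha one_half_pos, lintegral_exp_mul_gammaMeasure ha one_half_pos]
  have hiff : t ^ 2 / 2 < 1 / 8 ↔ t < 1 / 2 ∧ -t < 1 / 2 := by
    constructor
    · intro h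
      constructor <;> nlinarith
    · rintro ⟨h1, h2⟩
      nlinarith
  by_cases h1 : t < 1 / 2 <;> by_cases h2 : -t < 1 / 2
  · have h1' : 0 < 1 / 2 - t := sub_pos.2 h1
    have h2' : 0 < 1 / 2 - -t := sub_pos.2 h2
    have h3 : 0 < 1 / 8 - t ^ 2 / 2 := sub_pos.2 (hiff.2 ⟨h1, h2⟩)
    rw [if_pos h1, if_pos h2, if_pos (hiff.2 ⟨h1, h2⟩), ← ENNReal.ofReal_mul (by positivity),
      ← Real.mul_rpow (by positivity) (by positivity)]
    congr 2
    rw [div_mul_div_comm, div_eq_div_iff (by positivity) h3.ne']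
    ring
  · have h1' : 0 < 1 / 2 - t := sub_pos.2 h1
    rw [if_pos h1, if_neg h2, if_neg (fun h => h2 (hiff.1 h).2), ENNReal.mul_top]
    exact (ENNReal.ofReal_pos.2 (by positivity)).ne'
  · have h2' : 0 < 1 / 2 - -t := sub_pos.2 h2
    rw [if_neg h1, if_pos h2, if_neg (fun h => h1 (hiff.1 h).1), ENNReal.top_mul]
    exact (ENNReal.ofReal_pos.2 (by positivity)).ne'
  · linarith

lemma ncChiSqDiff_zero_eq_withDensity_gammaGaussianPdf {r : ℝ} (hr : 0 < r) :
    ncChiSqDiff r 0 0 = volume.withDensity (gammaGaussianPdf (r / 2) (1 / 8)) := by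
  have ha : 0 < r / 2 := by positivity
  have hprob : IsProbabilityMeasure (ncChiSqDiff r 0 0) := by
    have := isProbabilityMeasure_gammaMeasure ha one_half_pos
    rw [ncChiSqDiff, ncChiSq_zero_eq_gammaMeasure]
    exact Measure.isProbabilityMeasure_map (by fun_prop)
  refine ext_of_lintegral_exp_mul_eq (fun t => ?_) one_half_pos fun t ht => ?_
  · rw [lintegral_exp_mul_ncChiSqDiff_zero hr, lintegral_exp_mul_gammaGaussianPdf,
      lintegral_exp_mul_gammaMeasure ha (by norm_num)]
  · obtain ⟨h1, h2⟩ := abs_lt.1 ht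
    rw [lintegral_exp_mul_ncChiSqDiff_zero hr, if_pos (by nlinarith)]
    exact ENNReal.ofReal_ne_top

/-- Let `T = V₁ - V₂` with `V₁, V₂` independent, each following the central
chi-square distribution `χ'²_r(0)`, `r > 0`. Then `T` has probability density function
`p_T(x) = (1/(2^r √π Γ(r/2))) |x|^{(r-1)/2} K_{(r-1)/2}(|x|/2)`,
the density of a symmetric variance-gamma random variable. -/
theorem chiSqDiff_pdf (r : ℝ) (hr : 0 < r) :
    ncChiSqDiff r 0 0 =
      volume.withDensity fun x => ENNReal.ofReal
        (1 / (2 ^ r * Real.sqrt π * Real.Gamma (r / 2)) * |x| ^ ((r - 1) / 2) *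
          besselK ((r - 1) / 2) (|x| / 2)) := by
  rw [ncChiSqDiff_zero_eq_withDensity_gammaGaussianPdf hr]
  refine withDensity_congr_ae ?_
  have h0 : ∀ᵐ x : ℝ, x ≠ 0 := by simp [ae_iff]
  filter_upwards [h0] with x hx
  have hsqrt : √(2 * (1 / 8) : ℝ) = 1 / 2 := by
    rw [Real.sqrt_eq_iff_mul_self_eq_of_pos (by norm_num)]
    norm_num
  have hconst : (1 / 8 : ℝ) ^ (r / 2) * (√2)⁻¹ * 2 ^ ((r - 1) / 2) * 2 = (2 ^ r)⁻¹ := by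
    rw [Real.sqrt_eq_rpow, show (1 / 8 : ℝ) = 2 ^ (-3 : ℝ) by norm_num [Real.rpow_neg],
      ← Real.rpow_mul zero_le_two, ← Real.rpow_neg zero_le_two, ← Real.rpow_neg zero_le_two,
      ← Real.rpow_add zero_lt_two, ← Real.rpow_add zero_lt_two,
      ← Real.rpow_add_one two_ne_zero]
    ring_nf
  rw [gammaGaussianPdf_eq_besselK (by positivity) (by norm_num) hx, hsqrt,
    show |x| / (1 / 2) = 2 * |x| by ring, show 1 / 2 * |x| = |x| / 2 by ring,
    show r / 2 - 1 / 2 = (r - 1) / 2 by ring, Real.mul_rpow zero_le_two (abs_nonneg x),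
    Real.sqrt_mul zero_le_two]
  congr 1
  rw [one_div (2 ^ r * √π * Real.Gamma (r / 2)), mul_inv, mul_inv, mul_inv, ← hconst]
  ring

end
end

section
/- Let T = V₁ − V₂, where V₁ ~ χ'²_1(λ₁) and V₂ ~ χ'²_1(λ₂) are independent (r = 1 degree of freedom), with λ₁, λ₂ ≥ 0, and let p_T denote the probability density function of T (continuous on ℝ ∖ {0}). Then p_T has a logarithmic singularity at the origin with asymptotic behaviour p_T(x) ~ −(1/(2π)) e^{−(λ₁+λ₂)/2} ln|x| as x → 0; that is, lim_{x→0} p_T(x)/(−ln|x|) = (1/(2π)) e^{−(λ₁+λ₂)/2}. -/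
open MeasureTheory ProbabilityTheory Real

noncomputable section

open Filter Set Topology

theorem factorial_mul_Gamma_nat_add_half (k : ℕ) :
    (k.factorial : ℝ) * Real.Gamma ((k : ℝ) + 1 / 2) =
      ((2 * k).factorial : ℝ) * √π / 4 ^ k := by
  induction k with
  | zero => simpa using Real.Gamma_one_half_eq
  | succ k ih =>
    have h : ((k + 1 : ℕ) : ℝ) + 1 / 2 = ((k : ℝ) + 1 / 2) + 1 := by push_cast; ring
    rw [h, Real.Gamma_add_one (by positivity), Nat.factorial_succ,
      show 2 * (k + 1) = 2 * k + 1 + 1 by ring, Nat.factorial_succ, Nat.factorial_succ]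
    push_cast
    calc ((k : ℝ) + 1) * k.factorial * ((k + 1 / 2) * Real.Gamma (k + 1 / 2))
        = (k + 1) * (k + 1 / 2) * (k.factorial * Real.Gamma (k + 1 / 2)) := by ring
      _ = _ := by rw [ih]; field_simp; ring

theorem besselI_neg_half {y : ℝ} (hy : 0 < y) :
    besselI (-1 / 2) y = (y / 2) ^ (-1 / 2 : ℝ) / √π * Real.cosh y := by
  rw [besselI, Real.cosh_eq_tsum, ← tsum_mul_left]
  congr 1 with k
  have h : (k : ℝ) + -1 / 2 + 1 = k + 1 / 2 := by ring
  rw [h, factorial_mul_Gamma_nat_add_half, Real.rpow_add (by positivity),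
    show (2 * (k : ℝ)) = ((2 * k : ℕ) : ℝ) by push_cast; ring, Real.rpow_natCast, div_pow,
    pow_mul 2]
  norm_num
  field_simp

theorem ncChiSqPdf_one {lam x : ℝ} (hlam : 0 ≤ lam) (hx : 0 < x) :
    ncChiSqPdf 1 lam x =
      Real.exp (-(x + lam) / 2) * Real.cosh √(lam * x) / √(2 * π) / √x := by
  rw [ncChiSqPdf, if_neg hx.not_ge]
  have hs : x ^ (-1 / 2 : ℝ) = 1 / √x := by
    rw [Real.sqrt_eq_rpow, one_div, ← Real.rpow_neg hx.le]; norm_num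
  split_ifs with h0
  · subst h0
    rw [show (1 : ℝ) / 2 - 1 = -1 / 2 by norm_num, hs, Real.Gamma_one_half_eq,
      ← Real.sqrt_eq_rpow, Real.sqrt_mul zero_le_two]
    simp
    field_simp
  · have hl : 0 < lam := lt_of_le_of_ne hlam (Ne.symm h0)
    rw [show (1 : ℝ) / 2 - 1 = -1 / 2 by norm_num, besselI_neg_half (by positivity)]
    have h1 : (x / lam) ^ (1 / 4 - 1 / 2 : ℝ) * (√(lam * x) / 2) ^ (-1 / 2 : ℝ) =
        √2 / √x := by
      rw [Real.div_rpow hx.le hl.le, Real.div_rpow (by positivity) zero_le_two,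
        Real.sqrt_eq_rpow (lam * x), ← Real.rpow_mul (by positivity),
        Real.mul_rpow hl.le hx.le, Real.sqrt_eq_rpow, Real.sqrt_eq_rpow]
      norm_num
      rw [show (-(1 / 2) : ℝ) = - (1 / 4) + - (1 / 4) by norm_num,
        show (1 / 2 : ℝ) = 1 / 4 + 1 / 4 by norm_num]
      simp only [Real.rpow_add two_pos, Real.rpow_add hx, Real.rpow_neg hx.le,
        Real.rpow_neg hl.le, Real.rpow_neg zero_le_two]
      field_simp
    calc _ = 1 / 2 * Real.exp (-(x + lam) / 2) *
          ((x / lam) ^ (1 / 4 - 1 / 2 : ℝ) * (√(lam * x) / 2) ^ (-1 / 2 : ℝ)) / √π *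
          Real.cosh √(lam * x) := by ring
      _ = _ := by
        rw [h1, Real.sqrt_mul zero_le_two]
        field_simp
        rw [Real.sq_sqrt zero_le_two]

theorem measurable_ncChiSqPdf_one {lam : ℝ} (hlam : 0 ≤ lam) :
    Measurable (ncChiSqPdf 1 lam) := by
  have h : ncChiSqPdf 1 lam = (Ioi 0).indicator fun x =>
      Real.exp (-(x + lam) / 2) * Real.cosh √(lam * x) / √(2 * π) / √x := by
    ext x
    by_cases hx : 0 < x
    · rw [indicator_of_mem (mem_Ioi.2 hx), ncChiSqPdf_one hlam hx]
    · rw [indicator_of_notMem (by simpa using hx), ncChiSqPdf, if_pos (not_lt.1 hx)]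
  rw [h]
  refine Measurable.indicator ?_ measurableSet_Ioi
  exact ((Continuous.measurable (by fun_prop)).mul
    (Real.continuous_cosh.measurable.comp (Continuous.measurable (by fun_prop)))).div_const _
      |>.div (Continuous.measurable (by fun_prop))

theorem ncChiSqPdf_one_le {lam x : ℝ} (hlam : 0 ≤ lam) (hx : 0 < x) :
    ncChiSqPdf 1 lam x ≤ Real.exp (lam / 2) * Real.exp (-(1 / 4) * x) / √x := by
  rw [ncChiSqPdf_one hlam hx]
  gcongr
  have hc : Real.cosh √(lam * x) ≤ Real.exp (lam + x / 4) := by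
    have h1 : √(lam * x) ≤ lam + x / 4 := by
      rw [Real.sqrt_le_left (by positivity)]
      nlinarith [sq_nonneg (lam - x / 4)]
    have h2 : -√(lam * x) ≤ lam + x / 4 := by linarith [Real.sqrt_nonneg (lam * x)]
    rw [Real.cosh_eq]
    linarith [Real.exp_le_exp.2 h1, Real.exp_le_exp.2 h2]
  have hp : 1 ≤ √(2 * π) := Real.one_le_sqrt.2 (by linarith [Real.pi_gt_three])
  calc _ ≤ Real.exp (-(x + lam) / 2) * Real.cosh √(lam * x) :=
        div_le_self (by positivity) hp
    _ ≤ Real.exp (-(x + lam) / 2) * Real.exp (lam + x / 4) := by gcongr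
    _ = _ := by rw [← Real.exp_add, ← Real.exp_add]; ring_nf

theorem tendsto_sqrt_mul_ncChiSqPdf_one {lam : ℝ} (hlam : 0 ≤ lam) :
    Tendsto (fun x => √x * ncChiSqPdf 1 lam x) (𝓝[>] 0)
      (𝓝 (Real.exp (-lam / 2) / √(2 * π))) := by
  have h : Tendsto (fun x => Real.exp (-(x + lam) / 2) * Real.cosh √(lam * x) / √(2 * π))
      (𝓝[>] 0) (𝓝 (Real.exp (-lam / 2) / √(2 * π))) := by
    have hc : Continuous
        fun x => Real.exp (-(x + lam) / 2) * Real.cosh √(lam * x) / √(2 * π) :=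
      ((by fun_prop : Continuous fun x => Real.exp (-(x + lam) / 2)).mul
        (Real.continuous_cosh.comp (by fun_prop))).div_const _
    simpa using (hc.tendsto 0).mono_left nhdsWithin_le_nhds
  refine h.congr' ?_
  filter_upwards [self_mem_nhdsWithin] with x hx
  have := Real.sqrt_pos.2 hx
  rw [ncChiSqPdf_one hlam hx]
  field_simp

theorem lintegral_ncChiSqPdf_one_ne_top {lam : ℝ} (hlam : 0 ≤ lam) :
    ∫⁻ x, ENNReal.ofReal (ncChiSqPdf 1 lam x) ≠ ⊤ := by
  have hint : IntegrableOn (fun x : ℝ => Real.exp (lam / 2) *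
      (x ^ (-1 / 2 : ℝ) * Real.exp (-(1 / 4) * x ^ (1 : ℝ)))) (Ioi 0) :=
    (integrableOn_rpow_mul_exp_neg_mul_rpow (by norm_num) one_pos (by norm_num)).const_mul _
  refine ne_top_of_le_ne_top (Integrable.lintegral_lt_top hint).ne ?_
  rw [← lintegral_indicator measurableSet_Ioi]
  refine lintegral_mono fun x => ?_
  by_cases hx : 0 < x
  · rw [indicator_of_mem (mem_Ioi.2 hx)]
    refine ENNReal.ofReal_le_ofReal ((ncChiSqPdf_one_le hlam hx).trans_eq ?_)
    rw [Real.rpow_one, show (-1 / 2 : ℝ) = -(1 / 2) by norm_num, Real.rpow_neg hx.le,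
      ← Real.sqrt_eq_rpow]
    ring
  · simp [ncChiSqPdf, not_lt.1 hx]

theorem setLIntegral_inv_sqrt_mul_sqrt {t δ : ℝ} (ht : 0 < t) (hδ : 0 < δ) :
    ∫⁻ y in Ioc 0 δ, ENNReal.ofReal (1 / (√(t + y) * √y)) =
      ENNReal.ofReal (2 * Real.log (√δ + √(t + δ)) - Real.log t) := by
  have hcont : ContinuousOn (fun y => 2 * Real.log (√y + √(t + y))) (Icc 0 δ) := by
    refine continuousOn_const.mul (ContinuousOn.log (by fun_prop) fun y hy => ?_)
    have : 0 < √(t + y) := Real.sqrt_pos.2 (by linarith [hy.1])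
    positivity
  have hderiv : ∀ y ∈ Ioo 0 δ, HasDerivAt (fun y => 2 * Real.log (√y + √(t + y)))
      (1 / (√(t + y) * √y)) y := by
    intro y hy
    have hy0 : 0 < y := hy.1
    have hty : 0 < t + y := by linarith
    have h1 : 0 < √y := Real.sqrt_pos.2 hy0
    have h2 : 0 < √(t + y) := Real.sqrt_pos.2 hty
    have hd := (((Real.hasDerivAt_sqrt hy0.ne').add
      (((hasDerivAt_id y).const_add t).sqrt hty.ne')).log
        (by simp only [Pi.add_apply, id]; positivity)).const_mul 2
    refine hd.congr_deriv ?_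
    simp only [Pi.add_apply, id]
    field_simp
    ring
  have hpos : ∀ y, 0 ≤ 1 / (√(t + y) * √y) := fun y => by positivity
  have hint := intervalIntegral.integrableOn_deriv_of_nonneg hcont hderiv fun y _ => hpos y
  rw [← ofReal_integral_eq_lintegral_ofReal hint (ae_of_all _ hpos),
    ← intervalIntegral.integral_of_le hδ.le,
    intervalIntegral.integral_eq_sub_of_hasDerivAt_of_le hδ.le hcont hderiv
      ((intervalIntegrable_iff_integrableOn_Ioc_of_le hδ.le).2 hint)]
  congr 1
  simp [Real.log_sqrt ht.le]
  ring

/-- The density at `t` of the difference of independent variables with densities `f` and `g`. -/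
def crossCorr (f g : ℝ → ℝ) (t : ℝ) : ENNReal :=
  ∫⁻ y, ENNReal.ofReal (f (t + y)) * ENNReal.ofReal (g y)

theorem le_crossCorr {f g : ℝ → ℝ} {A B δ t : ℝ} (hA : 0 ≤ A) (hB : 0 ≤ B)
    (hf : ∀ x, 0 < x → x < 2 * δ → A / √x ≤ f x) (hg : ∀ x, 0 < x → x < 2 * δ → B / √x ≤ g x)
    (ht : 0 < t) (htδ : t < δ) :
    ENNReal.ofReal (A * B * (Real.log δ - Real.log t)) ≤ crossCorr f g t := by
  have hδ : 0 < δ := ht.trans htδ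
  calc ENNReal.ofReal (A * B * (Real.log δ - Real.log t))
      ≤ ENNReal.ofReal (A * B * (2 * Real.log (√δ + √(t + δ)) - Real.log t)) := by
        gcongr
        rw [← Real.sq_sqrt hδ.le, Real.log_pow, Real.sq_sqrt hδ.le]
        push_cast
        gcongr
        linarith [Real.sqrt_nonneg (t + δ)]
    _ = ENNReal.ofReal (A * B) * ∫⁻ y in Ioc 0 δ, ENNReal.ofReal (1 / (√(t + y) * √y)) := by
        rw [setLIntegral_inv_sqrt_mul_sqrt ht hδ, ENNReal.ofReal_mul (by positivity)]
    _ = ∫⁻ y in Ioc 0 δ, ENNReal.ofReal (A * B) * ENNReal.ofReal (1 / (√(t + y) * √y)) :=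
        (lintegral_const_mul' _ _ ENNReal.ofReal_ne_top).symm
    _ ≤ ∫⁻ y in Ioc 0 δ, ENNReal.ofReal (f (t + y)) * ENNReal.ofReal (g y) := by
        refine setLIntegral_mono' measurableSet_Ioc fun y hy => ?_
        have h1 := hf (t + y) (by linarith [hy.1]) (by linarith [hy.2])
        have h2 := hg y hy.1 (by linarith [hy.2])
        rw [← ENNReal.ofReal_mul (by positivity),
          ← ENNReal.ofReal_mul (le_trans (by positivity) h1)]
        refine ENNReal.ofReal_le_ofReal ?_
        calc A * B * (1 / (√(t + y) * √y)) = (A / √(t + y)) * (B / √y) := by ring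
          _ ≤ _ := mul_le_mul h1 h2 (by positivity) (le_trans (by positivity) h1)
    _ ≤ crossCorr f g t := setLIntegral_le_lintegral _ _

theorem crossCorr_le {f g : ℝ → ℝ} {A B D δ t : ℝ} (hA : 0 ≤ A) (hB : 0 ≤ B)
    (hf : ∀ x, 0 < x → x < 2 * δ → f x ≤ A / √x) (hg : ∀ x, 0 < x → x < 2 * δ → g x ≤ B / √x)
    (hfD : ∀ x, δ < x → f x ≤ D) (hg0 : ∀ x ≤ 0, g x = 0) (ht : 0 < t) (htδ : t < δ) :
    crossCorr f g t ≤ ENNReal.ofReal (A * B * (Real.log (8 * δ) - Real.log t)) +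
      ENNReal.ofReal D * ∫⁻ y, ENNReal.ofReal (g y) := by
  have hδ : 0 < δ := ht.trans htδ
  have hnear : ∫⁻ y in Ioc 0 δ, ENNReal.ofReal (f (t + y)) * ENNReal.ofReal (g y) ≤
      ENNReal.ofReal (A * B * (Real.log (8 * δ) - Real.log t)) :=
    calc _ ≤ ∫⁻ y in Ioc 0 δ, ENNReal.ofReal (A * B) * ENNReal.ofReal (1 / (√(t + y) * √y)) := by
          refine setLIntegral_mono' measurableSet_Ioc fun y hy => ?_
          have h1 := hf (t + y) (by linarith [hy.1]) (by linarith [hy.2])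
          have h2 := hg y hy.1 (by linarith [hy.2])
          calc _ ≤ ENNReal.ofReal (A / √(t + y)) * ENNReal.ofReal (B / √y) := by gcongr
            _ = _ := by
              rw [← ENNReal.ofReal_mul (by positivity), ← ENNReal.ofReal_mul (by positivity)]
              congr 1
              ring
      _ = ENNReal.ofReal (A * B * (2 * Real.log (√δ + √(t + δ)) - Real.log t)) := by
          rw [lintegral_const_mul' _ _ ENNReal.ofReal_ne_top,
            setLIntegral_inv_sqrt_mul_sqrt ht hδ, ENNReal.ofReal_mul (mul_nonneg hA hB)]
      _ ≤ _ := by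
          gcongr
          have h8 : √(2 * δ) ^ 2 * 4 = 8 * δ := by rw [Real.sq_sqrt (by positivity)]; ring
          rw [← h8, show (√(2 * δ) ^ 2 * 4 : ℝ) = (2 * √(2 * δ)) ^ 2 by ring, Real.log_pow]
          push_cast
          gcongr
          have h1 : √δ ≤ √(2 * δ) := Real.sqrt_le_sqrt (by linarith)
          have h2 : √(t + δ) ≤ √(2 * δ) := Real.sqrt_le_sqrt (by linarith)
          linarith
  have hfar : ∫⁻ y in (Ioc 0 δ)ᶜ, ENNReal.ofReal (f (t + y)) * ENNReal.ofReal (g y) ≤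
      ENNReal.ofReal D * ∫⁻ y, ENNReal.ofReal (g y) := by
    rw [← lintegral_const_mul' _ _ ENNReal.ofReal_ne_top]
    refine (setLIntegral_mono' measurableSet_Ioc.compl fun y hy => ?_).trans
      (setLIntegral_le_lintegral _ _)
    by_cases hy0 : y ≤ 0
    · simp [hg0 y hy0]
    · have hyδ : δ < y := by
        by_contra h
        exact hy ⟨not_le.1 hy0, not_lt.1 h⟩
      gcongr
      exact hfD _ (by linarith)
  rw [crossCorr, ← lintegral_add_compl _ measurableSet_Ioc]
  exact add_le_add hnear hfar

theorem tendsto_neg_log_nhdsGT_zero : Tendsto (fun t : ℝ => -Real.log t) (𝓝[>] 0) atTop :=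
  tendsto_neg_atBot_atTop.comp Real.tendsto_log_nhdsGT_zero

theorem exists_pos_of_tendsto_sqrt_mul {f : ℝ → ℝ} {a e : ℝ}
    (hf : Tendsto (fun x => √x * f x) (𝓝[>] 0) (𝓝 a)) (he : 0 < e) :
    ∃ η > 0, ∀ x, 0 < x → x < η → (a - e) / √x ≤ f x ∧ f x ≤ (a + e) / √x := by
  have h := hf.eventually (Icc_mem_nhds (sub_lt_self a he) (lt_add_of_pos_right a he))
  obtain ⟨η, hη, hsub⟩ := mem_nhdsGT_iff_exists_Ioo_subset.1 h
  refine ⟨η, hη, fun x hx hxη => ?_⟩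
  have hs : 0 < √x := Real.sqrt_pos.2 hx
  have := hsub ⟨hx, hxη⟩
  rw [div_le_iff₀ hs, le_div_iff₀ hs, mul_comm]
  exact this

theorem exists_common_pos_of_tendsto_sqrt_mul {f g : ℝ → ℝ} {a b e : ℝ}
    (hf : Tendsto (fun x => √x * f x) (𝓝[>] 0) (𝓝 a))
    (hg : Tendsto (fun x => √x * g x) (𝓝[>] 0) (𝓝 b)) (he : 0 < e) :
    ∃ δ > 0, ∀ x, 0 < x → x < 2 * δ →
      ((a - e) / √x ≤ f x ∧ f x ≤ (a + e) / √x) ∧ (b - e) / √x ≤ g x ∧ g x ≤ (b + e) / √x := by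
  obtain ⟨η, hη, h1⟩ := exists_pos_of_tendsto_sqrt_mul hf he
  obtain ⟨θ, hθ, h2⟩ := exists_pos_of_tendsto_sqrt_mul hg he
  refine ⟨min η θ / 2, by positivity, fun x hx hlt => ?_⟩
  rw [mul_div_cancel₀ _ two_ne_zero, lt_min_iff] at hlt
  exact ⟨h1 x hx hlt.1, h2 x hx hlt.2⟩

theorem eventually_le_crossCorr {f g : ℝ → ℝ} {a b C : ℝ} (ha : 0 < a) (hb : 0 < b)
    (hf : Tendsto (fun x => √x * f x) (𝓝[>] 0) (𝓝 a))
    (hg : Tendsto (fun x => √x * g x) (𝓝[>] 0) (𝓝 b)) (hC : C < a * b) :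
    ∀ᶠ t in 𝓝[>] 0, ENNReal.ofReal (C * -Real.log t) ≤ crossCorr f g t := by
  have hlim : Tendsto (fun e : ℝ => (a - e) * (b - e)) (𝓝[>] 0) (𝓝 (a * b)) := by
    have hc : Continuous fun e : ℝ => (a - e) * (b - e) := by fun_prop
    simpa using (hc.tendsto 0).mono_left nhdsWithin_le_nhds
  obtain ⟨e, heC, he, hlt⟩ := ((hlim.eventually_const_lt hC).and
    (Ioo_mem_nhdsGT (lt_min ha hb))).exists
  obtain ⟨δ, hδ, hfg⟩ := exists_common_pos_of_tendsto_sqrt_mul hf hg he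
  rw [lt_min_iff] at hlt
  have hbig := (tendsto_neg_log_nhdsGT_zero.const_mul_atTop (sub_pos.2 heC)).eventually_ge_atTop
    (-((a - e) * (b - e) * Real.log δ))
  filter_upwards [hbig, Ioo_mem_nhdsGT hδ] with t hbt ht
  refine le_trans (ENNReal.ofReal_le_ofReal ?_)
    (le_crossCorr (sub_nonneg.2 hlt.1.le) (sub_nonneg.2 hlt.2.le)
      (fun x h0 h => (hfg x h0 h).1.1) (fun x h0 h => (hfg x h0 h).2.1) ht.1 ht.2)
  linarith

theorem eventually_crossCorr_le {f g : ℝ → ℝ} {a b C : ℝ} (ha : 0 < a) (hb : 0 < b)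
    (hf : Tendsto (fun x => √x * f x) (𝓝[>] 0) (𝓝 a))
    (hg : Tendsto (fun x => √x * g x) (𝓝[>] 0) (𝓝 b))
    (hfD : ∀ δ > 0, ∃ D, ∀ x, δ < x → f x ≤ D) (hg0 : ∀ x ≤ 0, g x = 0)
    (hgint : ∫⁻ y, ENNReal.ofReal (g y) ≠ ⊤) (hC : a * b < C) :
    ∀ᶠ t in 𝓝[>] 0, crossCorr f g t ≤ ENNReal.ofReal (C * -Real.log t) := by
  have hlim : Tendsto (fun e : ℝ => (a + e) * (b + e)) (𝓝[>] 0) (𝓝 (a * b)) := by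
    have hc : Continuous fun e : ℝ => (a + e) * (b + e) := by fun_prop
    simpa using (hc.tendsto 0).mono_left nhdsWithin_le_nhds
  obtain ⟨e, heC, he⟩ := ((hlim.eventually_lt_const hC).and self_mem_nhdsWithin).exists
  have he : 0 < e := he
  obtain ⟨δ, hδ, hfg⟩ := exists_common_pos_of_tendsto_sqrt_mul hf hg he
  obtain ⟨D, hD⟩ := hfD δ hδ
  set R := ENNReal.ofReal D * ∫⁻ y, ENNReal.ofReal (g y) with hR
  have hRtop : R ≠ ⊤ := ENNReal.mul_ne_top ENNReal.ofReal_ne_top hgint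
  have hbig := (tendsto_neg_log_nhdsGT_zero.const_mul_atTop (sub_pos.2 heC)).eventually_ge_atTop
    ((a + e) * (b + e) * Real.log (8 * δ) + R.toReal)
  have hpos := tendsto_neg_log_nhdsGT_zero.eventually_ge_atTop (-Real.log (8 * δ))
  filter_upwards [hbig, hpos, Ioo_mem_nhdsGT hδ] with t hbt hpt ht
  refine (crossCorr_le (D := D) (by positivity) (by positivity)
    (fun x h0 h => (hfg x h0 h).1.2) (fun x h0 h => (hfg x h0 h).2.2) hD hg0 ht.1 ht.2).trans ?_
  rw [← hR, ← ENNReal.ofReal_toReal hRtop, ← ENNReal.ofReal_add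
    (mul_nonneg (by positivity) (by linarith)) ENNReal.toReal_nonneg]
  exact ENNReal.ofReal_le_ofReal (by linarith)

theorem crossCorr_neg (f g : ℝ → ℝ) (t : ℝ) : crossCorr f g (-t) = crossCorr g f t := by
  rw [crossCorr, ← lintegral_add_left_eq_self _ t, crossCorr]
  simp [mul_comm]

theorem map_sub_prod_withDensity {f g : ℝ → ℝ} (hf : Measurable f) (hg : Measurable g) :
    Measure.map (fun p : ℝ × ℝ => p.1 - p.2)
      ((volume.withDensity fun x => ENNReal.ofReal (f x)).prod
        (volume.withDensity fun x => ENNReal.ofReal (g x))) =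
      volume.withDensity (crossCorr f g) := by
  have hF : Measurable fun x => ENNReal.ofReal (f x) := hf.ennreal_ofReal
  have hG : Measurable fun x => ENNReal.ofReal (g x) := hg.ennreal_ofReal
  have hsub : Measurable fun p : ℝ × ℝ => p.1 - p.2 := by fun_prop
  ext s hs
  have hind : Measurable (s.indicator (1 : ℝ → ENNReal)) := measurable_one.indicator hs
  rw [prod_withDensity hF hG, Measure.map_apply hsub hs, withDensity_apply _ (hsub hs),
    withDensity_apply _ hs, ← lintegral_indicator (hsub hs), ← lintegral_indicator hs]
  calc ∫⁻ z : ℝ × ℝ, ((fun p : ℝ × ℝ => p.1 - p.2) ⁻¹' s).indicator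
        (fun z => ENNReal.ofReal (f z.1) * ENNReal.ofReal (g z.2)) z ∂volume.prod volume
      = ∫⁻ z : ℝ × ℝ, s.indicator 1 (z.1 - z.2) *
          (ENNReal.ofReal (f z.1) * ENNReal.ofReal (g z.2)) ∂volume.prod volume := by
        congr 1 with z
        by_cases h : z.1 - z.2 ∈ s <;> simp [indicator, h]
    _ = ∫⁻ y, ∫⁻ x, s.indicator 1 (x - y) *
          (ENNReal.ofReal (f x) * ENNReal.ofReal (g y)) :=
        lintegral_prod_symm' _ (by fun_prop)
    _ = ∫⁻ y, ∫⁻ x, s.indicator 1 x *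
          (ENNReal.ofReal (f (x + y)) * ENNReal.ofReal (g y)) := by
        congr 1 with y
        rw [← lintegral_add_right_eq_self _ y]
        simp
    _ = ∫⁻ x, ∫⁻ y, s.indicator 1 x *
          (ENNReal.ofReal (f (x + y)) * ENNReal.ofReal (g y)) :=
        lintegral_lintegral_swap (by fun_prop)
    _ = ∫⁻ x, s.indicator (crossCorr f g) x := by
        congr 1 with x
        by_cases h : x ∈ s <;> simp [indicator, h, crossCorr]

theorem measurable_crossCorr {f g : ℝ → ℝ} (hf : Measurable f) (hg : Measurable g) :
    Measurable (crossCorr f g) := by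
  have h : Measurable fun p : ℝ × ℝ => ENNReal.ofReal (f (p.1 + p.2)) * ENNReal.ofReal (g p.2) := by
    fun_prop
  exact h.lintegral_prod_right'

theorem eventually_nhdsNE_zero_of_neg {P : ℝ → ℝ → Prop} (h₁ : ∀ᶠ t in 𝓝[>] (0 : ℝ), P t t)
    (h₂ : ∀ᶠ t in 𝓝[>] (0 : ℝ), P (-t) t) : ∀ᶠ x in 𝓝[≠] (0 : ℝ), P x |x| := by
  filter_upwards [tendsto_abs_nhdsNE_zero.eventually h₁,
    tendsto_abs_nhdsNE_zero.eventually h₂] with x hx₁ hx₂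
  rcases abs_choice x with h | h
  · rwa [h] at hx₁ ⊢
  · rwa [h, neg_neg, ← h] at hx₂

theorem eventually_le_of_ae_imp_le {p h : ℝ → ℝ} {P : ℝ → Prop} {a : ℝ}
    (hp : ContinuousOn p {a}ᶜ) (hh : ContinuousOn h {a}ᶜ) (hP : ∀ᶠ x in 𝓝[≠] a, P x)
    (hae : ∀ᵐ x, P x → p x ≤ h x) : ∀ᶠ x in 𝓝[≠] a, p x ≤ h x := by
  obtain ⟨V, hVo, haV, hV⟩ := mem_nhdsWithin.1 hP
  have hUo : IsOpen (V ∩ {a}ᶜ) := hVo.inter isOpen_compl_singleton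
  have hUp := hp.mono (inter_subset_right : V ∩ {a}ᶜ ⊆ _)
  have hUh := hh.mono (inter_subset_right : V ∩ {a}ᶜ ⊆ _)
  have heq : EqOn (fun x => max (p x) (h x)) h (V ∩ {a}ᶜ) := by
    refine Measure.eqOn_open_of_ae_eq (μ := volume) ?_ hUo (hUp.sup hUh) hUh
    refine (ae_restrict_iff' hUo.measurableSet).2 ?_
    filter_upwards [hae] with x hx hxU using max_eq_right (hx (hV hxU))
  filter_upwards [mem_nhdsWithin.2 ⟨V, hVo, haV, Subset.rfl⟩] with x hx
  exact max_eq_right_iff.1 (heq hx)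

theorem exists_bound_ncChiSqPdf_one {lam : ℝ} (hlam : 0 ≤ lam) {δ : ℝ} (hδ : 0 < δ) :
    ∃ D, ∀ x, δ < x → ncChiSqPdf 1 lam x ≤ D := by
  refine ⟨Real.exp (lam / 2) * 1 / √δ, fun x hx => ?_⟩
  refine (ncChiSqPdf_one_le hlam (hδ.trans hx)).trans ?_
  have : 0 < √δ := Real.sqrt_pos.2 hδ
  gcongr
  exact Real.exp_le_one_iff.2 (by linarith)

theorem ncChiSqPdf_of_nonpos (r lam : ℝ) {x : ℝ} (hx : x ≤ 0) : ncChiSqPdf r lam x = 0 :=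
  if_pos hx

/-- Let `T = V₁ - V₂` with `V₁ ~ χ'²_1(λ₁)` and `V₂ ~ χ'²_1(λ₂)` independent
(`r = 1` degree of freedom), `λ₁, λ₂ ≥ 0`, and let `p_T` denote the probability density
function of `T`, continuous on `ℝ \ {0}`. Then `p_T` has a logarithmic singularity at the
origin: `p_T(x) ∼ -(1/(2π)) e^{-(λ₁+λ₂)/2} ln |x|` as `x → 0`, i.e.
`lim_{x→0} p_T(x)/(-ln |x|) = (1/(2π)) e^{-(λ₁+λ₂)/2}`. -/
theorem ncChiSqDiff_pdf_log_singularity (lam1 lam2 : ℝ) (h1 : 0 ≤ lam1) (h2 : 0 ≤ lam2)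
    (pT : ℝ → ℝ) (hcont : ContinuousOn pT {(0 : ℝ)}ᶜ)
    (hpdf : ncChiSqDiff 1 lam1 lam2 = volume.withDensity fun x => ENNReal.ofReal (pT x)) :
    Filter.Tendsto (fun x : ℝ => pT x / (-Real.log |x|)) (nhdsWithin 0 {(0 : ℝ)}ᶜ)
      (nhds (1 / (2 * π) * Real.exp (-(lam1 + lam2) / 2))) := by
  set p₁ := ncChiSqPdf 1 lam1
  set p₂ := ncChiSqPdf 1 lam2
  set a := Real.exp (-lam1 / 2) / √(2 * π) with ha
  set b := Real.exp (-lam2 / 2) / √(2 * π) with hb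
  have ha0 : 0 < a := by positivity
  have hb0 : 0 < b := by positivity
  have hab : 1 / (2 * π) * Real.exp (-(lam1 + lam2) / 2) = a * b := by
    rw [ha, hb, div_mul_div_comm, ← Real.exp_add, Real.mul_self_sqrt (by positivity)]
    ring_nf
  have hm₁ : Measurable p₁ := measurable_ncChiSqPdf_one h1
  have hm₂ : Measurable p₂ := measurable_ncChiSqPdf_one h2
  have ht₁ := tendsto_sqrt_mul_ncChiSqPdf_one h1
  have ht₂ := tendsto_sqrt_mul_ncChiSqPdf_one h2
  have hpm : AEMeasurable pT := by
    have h := hcont.aemeasurable (μ := volume) (measurableSet_singleton (0 : ℝ)).compl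
    rwa [restrict_compl_singleton] at h
  have hae : ∀ᵐ x, crossCorr p₁ p₂ x = ENNReal.ofReal (pT x) := by
    refine (withDensity_eq_iff_of_sigmaFinite (measurable_crossCorr hm₁ hm₂).aemeasurable
      hpm.ennreal_ofReal).1 ?_
    rw [← hpdf, ← map_sub_prod_withDensity hm₁ hm₂]
    rfl
  have hlogc : ∀ C : ℝ, ContinuousOn (fun x : ℝ => C * -Real.log |x|) {(0 : ℝ)}ᶜ := fun C =>
    continuousOn_const.mul (ContinuousOn.log (by fun_prop) fun x hx => abs_ne_zero.2 hx).neg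
  have hlogpos : ∀ᶠ x in 𝓝[≠] (0 : ℝ), 0 < -Real.log |x| :=
    (tendsto_neg_log_nhdsGT_zero.comp tendsto_abs_nhdsNE_zero).eventually_gt_atTop 0
  have hlower : ∀ C, 0 < C → C < a * b → ∀ᶠ x in 𝓝[≠] (0 : ℝ), C * -Real.log |x| ≤ pT x := by
    intro C hC0 hC
    have hK : ∀ᶠ x in 𝓝[≠] (0 : ℝ),
        ENNReal.ofReal (C * -Real.log |x|) ≤ crossCorr p₁ p₂ x :=
      eventually_nhdsNE_zero_of_neg
        (P := fun x t => ENNReal.ofReal (C * -Real.log t) ≤ crossCorr p₁ p₂ x)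
        (eventually_le_crossCorr ha0 hb0 ht₁ ht₂ hC)
        (by simpa only [crossCorr_neg] using
          eventually_le_crossCorr hb0 ha0 ht₂ ht₁ (by rwa [mul_comm]))
    refine eventually_le_of_ae_imp_le (hlogc C) hcont (hK.and hlogpos) ?_
    filter_upwards [hae] with x hx ⟨hle, hl⟩
    rw [hx] at hle
    exact (ENNReal.ofReal_le_ofReal_iff'.1 hle).resolve_right (mul_pos hC0 hl).not_ge
  have hupper : ∀ C, a * b < C → ∀ᶠ x in 𝓝[≠] (0 : ℝ), pT x ≤ C * -Real.log |x| := by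
    intro C hC
    have hK : ∀ᶠ x in 𝓝[≠] (0 : ℝ),
        crossCorr p₁ p₂ x ≤ ENNReal.ofReal (C * -Real.log |x|) :=
      eventually_nhdsNE_zero_of_neg
        (P := fun x t => crossCorr p₁ p₂ x ≤ ENNReal.ofReal (C * -Real.log t))
        (eventually_crossCorr_le ha0 hb0 ht₁ ht₂ (fun _ => exists_bound_ncChiSqPdf_one h1)
          (fun _ => ncChiSqPdf_of_nonpos 1 lam2) (lintegral_ncChiSqPdf_one_ne_top h2) hC)
        (by simpa only [crossCorr_neg] using
          eventually_crossCorr_le hb0 ha0 ht₂ ht₁ (fun _ => exists_bound_ncChiSqPdf_one h2)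
                (fun _ => ncChiSqPdf_of_nonpos 1 lam1) (lintegral_ncChiSqPdf_one_ne_top h1)
                (by rwa [mul_comm]))
    refine eventually_le_of_ae_imp_le hcont (hlogc C) (hK.and hlogpos) ?_
    filter_upwards [hae] with x hx ⟨hle, hl⟩
    rw [hx] at hle
    have hC0 : 0 < C := (mul_pos ha0 hb0).trans hC
    exact (ENNReal.ofReal_le_ofReal_iff (mul_pos hC0 hl).le).1 hle
  rw [hab]
  refine tendsto_order.2 ⟨fun c hc => ?_, fun c hc => ?_⟩
  · obtain ⟨C, hcC, hC⟩ := exists_between (max_lt hc (mul_pos ha0 hb0))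
    rw [max_lt_iff] at hcC
    filter_upwards [hlower C hcC.2 hC, hlogpos] with x hx hl
    exact hcC.1.trans_le ((le_div_iff₀ hl).2 hx)
  · obtain ⟨C, hC, hCc⟩ := exists_between hc
    filter_upwards [hupper C hC, hlogpos] with x hx hl
    exact ((div_le_iff₀ hl).2 hx).trans_lt hCc

end
end
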